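/- arXiv:1903.12304 — 9 statements merged into one kernel-verified Lean document; each statement's English description precedes it below -/
import Mathlib

section
/- Marginal entropy bound for threshold quantum secret sharing: let k ≥ 2, d ≥ 2, and let V be an isometry from ℂ^d into a tensor product H_1⊗⋯⊗H_{2k-1} of finite-dimensional complex Hilbert spaces such that for every subset U ⊆ {1, …, 2k-1} with |U| ≤ k-1, the reduced density matrix of VρV† on the factors in U is the same for all density matrices ρ on ℂ^d (unauthorized sets carry no information about the secret). Then for every party i ∈ {1, …, 2k-1} and every density matrix ρ on ℂ^d, the reduced density matrix of VρV† on H_i has von Neumann entropy at least log₂ d. -/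
open Matrix Kronecker
open scoped ComplexOrder

noncomputable section

/-- A density matrix: positive semidefinite with trace 1. -/
def IsDensity {n : Type*} [Fintype n] (ρ : Matrix n n ℂ) : Prop :=
  ρ.PosSemidef ∧ ρ.trace = 1

/-- The outer product `|v⟩⟨v|`. -/
def outer {n : Type*} (v : n → ℂ) : Matrix n n ℂ :=
  Matrix.of fun i j => v i * (starRingEnd ℂ) (v j)

/-- Partial trace over the second tensor factor. -/
def ptrace2 {m n : Type*} [Fintype n] (M : Matrix (m × n) (m × n) ℂ) :
    Matrix m m ℂ := Matrix.of fun i i' => ∑ j, M (i, j) (i', j)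

/-- Partial trace over the first tensor factor. -/
def ptrace1 {m n : Type*} [Fintype m] (M : Matrix (m × n) (m × n) ℂ) :
    Matrix n n ℂ := Matrix.of fun j j' => ∑ i, M (i, j) (i, j')

/-- `(M, ω)` is a universal quantum masker for `d`-dimensional states:
`M` is a unitary from `ℂ^d ⊗ ℂ^s` to `ℂ^{dA} ⊗ ℂ^{dB}`, `ω` is a density matrix on `ℂ^s`,
and both marginals of `Φ(ρ) = M (ρ ⊗ ω) M†` are independent of the input density matrix `ρ`. -/
def IsMasker (d s dA dB : ℕ) (M : Matrix (Fin dA × Fin dB) (Fin d × Fin s) ℂ)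
    (ω : Matrix (Fin s) (Fin s) ℂ) : Prop :=
  Mᴴ * M = 1 ∧ M * Mᴴ = 1 ∧ IsDensity ω ∧
  ∃ (σA : Matrix (Fin dA) (Fin dA) ℂ) (σB : Matrix (Fin dB) (Fin dB) ℂ),
    IsDensity σA ∧ IsDensity σB ∧
    ∀ ρ : Matrix (Fin d) (Fin d) ℂ, IsDensity ρ →
      ptrace2 (M * (ρ ⊗ₖ ω) * Mᴴ) = σA ∧ ptrace1 (M * (ρ ⊗ₖ ω) * Mᴴ) = σB

/-- Von Neumann entropy in bits: `-∑ λ log₂ λ` over the eigenvalues. -/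
def vNEntropy {n : Type*} [Fintype n] [DecidableEq n] (ρ : Matrix n n ℂ) : ℝ :=
  if h : ρ.IsHermitian then -∑ i, h.eigenvalues i * Real.logb 2 (h.eigenvalues i)
  else 0

/-- Reduced density matrix on the subset `S` of the tensor factors (partial trace over the
complement). -/
def reduced {P : Type*} [Fintype P] [DecidableEq P] {dim : P → ℕ}
    (S : Finset P) (ρ : Matrix (∀ p, Fin (dim p)) (∀ p, Fin (dim p)) ℂ) :
    Matrix (∀ p : {p // p ∈ S}, Fin (dim p.1)) (∀ p : {p // p ∈ S}, Fin (dim p.1)) ℂ :=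
  Matrix.of fun x y => ∑ z : ∀ p : {p // p ∉ S}, Fin (dim p.1),
    ρ (fun p => if h : p ∈ S then x ⟨p, h⟩ else z ⟨p, h⟩)
      (fun p => if h : p ∈ S then y ⟨p, h⟩ else z ⟨p, h⟩)

/-- The von Neumann entropy as a sum over the roots of the characteristic polynomial. -/
theorem vNEntropy_eq_sum_roots {n : Type*} [Fintype n] [DecidableEq n] {ρ : Matrix n n ℂ}
    (h : ρ.IsHermitian) :
    vNEntropy ρ = (ρ.charpoly.roots.map fun z => -(z.re * Real.logb 2 z.re)).sum := by
  rw [vNEntropy, dif_pos h, h.roots_charpoly_eq_eigenvalues, Multiset.map_map,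
    ← Finset.sum_neg_distrib]
  rfl

theorem vNEntropy_eq_of_charpoly_eq {m n : Type*} [Fintype m] [DecidableEq m] [Fintype n]
    [DecidableEq n] {ρ : Matrix m m ℂ} {σ : Matrix n n ℂ} (hρ : ρ.IsHermitian)
    (hσ : σ.IsHermitian) (h : ρ.charpoly = σ.charpoly) : vNEntropy ρ = vNEntropy σ := by
  rw [vNEntropy_eq_sum_roots hρ, vNEntropy_eq_sum_roots hσ, h]

theorem vNEntropy_diagonal {n : Type*} [Fintype n] [DecidableEq n] (v : n → ℝ) :
    vNEntropy (diagonal fun i => (v i : ℂ)) = ∑ i, -(v i * Real.logb 2 (v i)) := by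
  rw [vNEntropy_eq_sum_roots, charpoly_diagonal, Polynomial.roots_prod]
  · simp only [Polynomial.roots_X_sub_C, Multiset.bind_singleton, Multiset.map_map,
      Function.comp_def, Complex.ofReal_re]
    rfl
  · simp [Finset.prod_ne_zero_iff, Polynomial.X_sub_C_ne_zero]
  · ext i j
    by_cases hij : i = j
    · subst hij; simp
    · simp [hij, Ne.symm hij]

/-- `A Aᴴ` and `Aᴴ A` have the same entropy. -/
theorem vNEntropy_mul_conjTranspose_comm {m n : Type*} [Fintype m] [DecidableEq m] [Fintype n]
    [DecidableEq n] (A : Matrix m n ℂ) : vNEntropy (A * Aᴴ) = vNEntropy (Aᴴ * A) := by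
  rw [vNEntropy_eq_sum_roots (isHermitian_mul_conjTranspose_self A),
    vNEntropy_eq_sum_roots (isHermitian_conjTranspose_mul_self A)]
  have h := congrArg Polynomial.roots (charpoly_mul_comm' A Aᴴ)
  have hX : ∀ k : ℕ, (Polynomial.X ^ k : Polynomial ℂ) ≠ 0 := fun k =>
    pow_ne_zero _ Polynomial.X_ne_zero
  rw [Polynomial.roots_mul (mul_ne_zero (hX _) (charpoly_monic _).ne_zero),
    Polynomial.roots_mul (mul_ne_zero (hX _) (charpoly_monic _).ne_zero)] at h
  have h' := congrArg (fun s : Multiset ℂ => (s.map fun z => -(z.re * Real.logb 2 z.re)).sum) h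
  simpa [Multiset.map_nsmul, Multiset.sum_nsmul] using h'

theorem vNEntropy_conj {n : Type*} [Fintype n] [DecidableEq n] {ρ U : Matrix n n ℂ}
    (hρ : ρ.IsHermitian) (hU : U * Uᴴ = 1) : vNEntropy (Uᴴ * ρ * U) = vNEntropy ρ := by
  refine vNEntropy_eq_of_charpoly_eq (isHermitian_conjTranspose_mul_mul U hρ) hρ ?_
  rw [charpoly_mul_comm, ← mul_assoc, hU, one_mul]

theorem vNEntropy_transpose {n : Type*} [Fintype n] [DecidableEq n] {ρ : Matrix n n ℂ}
    (hρ : ρ.IsHermitian) : vNEntropy ρᵀ = vNEntropy ρ :=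
  vNEntropy_eq_of_charpoly_eq hρ.transpose hρ (charpoly_transpose ρ)

/-- Unitary diagonalization of a Hermitian matrix. -/
theorem exists_unitary_conj_eq_diagonal {n : Type*} [Fintype n] [DecidableEq n]
    {ρ : Matrix n n ℂ} (hρ : ρ.IsHermitian) :
    ∃ U : Matrix n n ℂ, U * Uᴴ = 1 ∧ Uᴴ * U = 1 ∧
      Uᴴ * ρ * U = diagonal fun i => (hρ.eigenvalues i : ℂ) := by
  refine ⟨hρ.eigenvectorUnitary, ?_, ?_, ?_⟩
  · exact Unitary.coe_mul_star_self hρ.eigenvectorUnitary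
  · exact Unitary.coe_star_mul_self hρ.eigenvectorUnitary
  · have h := hρ.conjStarAlgAut_star_eigenvectorUnitary
    rw [Unitary.conjStarAlgAut_star_apply] at h
    exact h

/-- The entropy is additive on the product of a maximally mixed state and a density matrix. -/
theorem vNEntropy_maximallyMixed_kronecker {n : Type*} [Fintype n] [DecidableEq n]
    {d : ℕ} (hd : d ≠ 0) {σ : Matrix n n ℂ} (hσ : IsDensity σ) :
    vNEntropy ((d : ℂ)⁻¹ • ((1 : Matrix (Fin d) (Fin d) ℂ) ⊗ₖ σ)) =
      Real.logb 2 d + vNEntropy σ := by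
  have hH := hσ.1.isHermitian
  obtain ⟨U, hU, hU', hD⟩ := exists_unitary_conj_eq_diagonal hH
  have hM : ((d : ℂ)⁻¹ • ((1 : Matrix (Fin d) (Fin d) ℂ) ⊗ₖ σ)).IsHermitian := by
    ext i j
    simp only [conjTranspose_apply, Matrix.smul_apply, kroneckerMap_apply, smul_eq_mul, star_mul']
    rw [hH.apply]
    by_cases h : i.1 = j.1
    · simp [h, Matrix.one_apply]
    · simp [Matrix.one_apply_ne h, Matrix.one_apply_ne (Ne.symm h)]
  have hW : ((1 : Matrix (Fin d) (Fin d) ℂ) ⊗ₖ U) * ((1 : Matrix (Fin d) (Fin d) ℂ) ⊗ₖ U)ᴴ = 1 := by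
    rw [conjTranspose_kronecker, ← mul_kronecker_mul, hU]; simp
  rw [← vNEntropy_conj hM hW, ← vNEntropy_conj hH hU, hD]
  have hdiag : ((1 : Matrix (Fin d) (Fin d) ℂ) ⊗ₖ U)ᴴ *
      ((d : ℂ)⁻¹ • ((1 : Matrix (Fin d) (Fin d) ℂ) ⊗ₖ σ)) * ((1 : Matrix (Fin d) (Fin d) ℂ) ⊗ₖ U) =
      diagonal fun p : Fin d × n => (((d : ℝ)⁻¹ * hH.eigenvalues p.2 : ℝ) : ℂ) := by
    rw [conjTranspose_kronecker, Matrix.mul_smul, Matrix.smul_mul, ← mul_kronecker_mul,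
      ← mul_kronecker_mul, hD]
    ext i j
    by_cases h : i = j
    · subst h; simp
    · have h' : ¬ (i.1 = j.1 ∧ i.2 = j.2) := fun hh => h (Prod.ext hh.1 hh.2)
      simp only [Matrix.smul_apply, kroneckerMap_apply, diagonal_apply, if_neg h]
      by_cases h1 : i.1 = j.1
      · have h2 : i.2 ≠ j.2 := fun hh => h' ⟨h1, hh⟩
        simp [h2]
      · simp [Matrix.one_apply_ne h1]
  have hsum : ∑ i, hH.eigenvalues i = 1 := by
    simpa [hσ.2] using (congrArg Complex.re hH.trace_eq_sum_eigenvalues).symm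
  have hd' : (d : ℝ) ≠ 0 := by exact_mod_cast hd
  rw [hdiag, vNEntropy_diagonal, vNEntropy_diagonal, Fintype.sum_prod_type]
  have key : ∀ i, (d : ℝ) * -((d : ℝ)⁻¹ * hH.eigenvalues i *
      Real.logb 2 ((d : ℝ)⁻¹ * hH.eigenvalues i)) =
      Real.logb 2 d * hH.eigenvalues i + -(hH.eigenvalues i * Real.logb 2 (hH.eigenvalues i)) := by
    intro i
    rcases eq_or_ne (hH.eigenvalues i) 0 with h0 | h0
    · simp [h0]
    · rw [Real.logb_mul (inv_ne_zero hd') h0, Real.logb_inv]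
      field_simp
      ring
  simp only [Finset.sum_const, Finset.card_univ, Fintype.card_fin, nsmul_eq_mul]
  rw [Finset.mul_sum, Finset.sum_congr rfl fun i _ => key i, Finset.sum_add_distrib,
    ← Finset.mul_sum, hsum, mul_one]

/-- Subadditivity for a probability vector `l` and the marginals `q`, `r` of its image under a
bistochastic kernel `D`. -/
theorem sum_entropy_le_of_bistochastic {κ m n : Type*} [Fintype κ] [Fintype m] [Fintype n]
    (D : m × n → κ → ℝ) (l : κ → ℝ) (q : m → ℝ) (r : n → ℝ)
    (hD : ∀ p c, 0 ≤ D p c) (hl : ∀ c, 0 ≤ l c)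
    (hrow : ∀ p, ∑ c, D p c = 1) (hcol : ∀ c, ∑ p, D p c = 1) (hsum : ∑ c, l c = 1)
    (hq : ∀ a, q a = ∑ b, ∑ c, D (a, b) c * l c)
    (hr : ∀ b, r b = ∑ a, ∑ c, D (a, b) c * l c) :
    ∑ c, -(l c * Real.logb 2 (l c)) ≤
      ∑ a, -(q a * Real.logb 2 (q a)) + ∑ b, -(r b * Real.logb 2 (r b)) := by
  have hDl : ∀ p c, 0 ≤ D p c * l c := fun p c => mul_nonneg (hD p c) (hl c)
  have hq0 : ∀ a, 0 ≤ q a := fun a => by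
    rw [hq]; exact Finset.sum_nonneg fun b _ => Finset.sum_nonneg fun c _ => hDl _ _
  have hr0 : ∀ b, 0 ≤ r b := fun b => by
    rw [hr]; exact Finset.sum_nonneg fun b _ => Finset.sum_nonneg fun c _ => hDl _ _
  have hle_q : ∀ a b c, D (a, b) c * l c ≤ q a := fun a b c => by
    rw [hq]
    exact (Finset.single_le_sum (f := fun c => D (a, b) c * l c) (fun c _ => hDl _ c)
      (Finset.mem_univ c)).trans
      (Finset.single_le_sum (f := fun b => ∑ c, D (a, b) c * l c)
        (fun b _ => Finset.sum_nonneg fun c _ => hDl _ c) (Finset.mem_univ b))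
  have hle_r : ∀ a b c, D (a, b) c * l c ≤ r b := fun a b c => by
    rw [hr]
    exact (Finset.single_le_sum (f := fun c => D (a, b) c * l c) (fun c _ => hDl _ c)
      (Finset.mem_univ c)).trans
      (Finset.single_le_sum (f := fun a => ∑ c, D (a, b) c * l c)
        (fun b _ => Finset.sum_nonneg fun c _ => hDl _ c) (Finset.mem_univ a))
  have hterm : ∀ a b c, D (a, b) c * l c * (Real.log (q a) + Real.log (r b) - Real.log (l c)) ≤
      D (a, b) c * (q a * r b - l c) := by
    intro a b c
    rcases (hDl (a, b) c).eq_or_lt with h0 | hpos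
    · rw [← h0, zero_mul, mul_sub, ← h0, sub_zero]
      exact mul_nonneg (hD _ _) (mul_nonneg (hq0 a) (hr0 b))
    · have hlc : 0 < l c := lt_of_le_of_ne (hl c) fun h => by simp [← h] at hpos
      have hqa := hpos.trans_le (hle_q a b c)
      have hrb := hpos.trans_le (hle_r a b c)
      have hlog := Real.log_le_sub_one_of_pos (div_pos (mul_pos hqa hrb) hlc)
      rw [Real.log_div (mul_pos hqa hrb).ne' hlc.ne', Real.log_mul hqa.ne' hrb.ne'] at hlog
      refine (mul_le_mul_of_nonneg_left hlog hpos.le).trans_eq ?_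
      field_simp
  have hswap : ∑ c, l c = ∑ a, q a := by
    simp_rw [hq, ← Fintype.sum_prod_type (f := fun p : m × n => ∑ c, D p c * l c)]
    rw [Finset.sum_comm]
    simp [← Finset.sum_mul, hcol]
  have hswap' : ∑ c, l c = ∑ b, r b := by
    rw [hswap]; simp_rw [hq, hr]; exact Finset.sum_comm
  have hR : ∑ a, ∑ b, ∑ c, D (a, b) c * (q a * r b - l c) = 0 := by
    simp_rw [mul_sub, Finset.sum_sub_distrib, ← hq, ← Finset.sum_mul, hrow, one_mul,
      ← Finset.mul_sum, ← Finset.sum_mul]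
    rw [← hswap, ← hswap', hsum]; norm_num
  have hL : ∑ a, ∑ b, ∑ c, D (a, b) c * l c * (Real.log (q a) + Real.log (r b) - Real.log (l c)) =
      ∑ a, q a * Real.log (q a) + ∑ b, r b * Real.log (r b) - ∑ c, l c * Real.log (l c) := by
    simp_rw [mul_sub, mul_add, Finset.sum_sub_distrib, Finset.sum_add_distrib]
    congr 1
    · congr 1
      · simp_rw [hq, Finset.sum_mul]
      · rw [Finset.sum_comm]
        refine Finset.sum_congr rfl fun b _ => ?_
        simp_rw [hr b, Finset.sum_mul]
    · rw [← Fintype.sum_prod_type (f := fun p : m × n => ∑ c, D p c * l c * Real.log (l c)),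
        Finset.sum_comm]
      simp [← Finset.sum_mul, hcol]
  have hmain := Finset.sum_le_sum fun a (_ : a ∈ Finset.univ) =>
    Finset.sum_le_sum fun b (_ : b ∈ Finset.univ) =>
      Finset.sum_le_sum fun c (_ : c ∈ Finset.univ) => hterm a b c
  rw [hL, hR] at hmain
  have h2 : 0 < Real.log 2 := Real.log_pos one_lt_two
  simp only [Real.logb, ← mul_div_assoc, ← neg_div, ← Finset.sum_div, ← add_div,
    Finset.sum_neg_distrib]
  gcongr
  linarith

/-- Subadditivity of the entropy for a bipartite state with diagonal marginals. -/
theorem vNEntropy_le_of_ptrace_eq_diagonal {m n : Type*} [Fintype m] [DecidableEq m] [Fintype n]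
    [DecidableEq n] {ρ : Matrix (m × n) (m × n) ℂ} (hρ : IsDensity ρ) {q : m → ℝ} {r : n → ℝ}
    (hq : ptrace2 ρ = diagonal fun a => (q a : ℂ)) (hr : ptrace1 ρ = diagonal fun b => (r b : ℂ)) :
    vNEntropy ρ ≤ vNEntropy (ptrace2 ρ) + vNEntropy (ptrace1 ρ) := by
  have hH := hρ.1.isHermitian
  obtain ⟨U, hU, hU', hD⟩ := exists_unitary_conj_eq_diagonal hH
  have hρU : ρ = U * (diagonal fun i => (hH.eigenvalues i : ℂ)) * Uᴴ := by
    rw [← hD]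
    simp only [← mul_assoc, hU, one_mul]
    rw [mul_assoc, hU, mul_one]
  have hdiag : ∀ p, ρ p p = ((∑ c, Complex.normSq (U p c) * hH.eigenvalues c : ℝ) : ℂ) := by
    intro p
    conv_lhs => rw [hρU, mul_apply]
    simp only [mul_diagonal, conjTranspose_apply, Complex.ofReal_sum,
      Complex.ofReal_mul, ← Complex.mul_conj, starRingEnd_apply]
    exact Finset.sum_congr rfl fun c _ => by ring
  have hsum : ∑ i, hH.eigenvalues i = 1 := by
    simpa [hρ.2] using (congrArg Complex.re hH.trace_eq_sum_eigenvalues).symm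
  rw [← vNEntropy_conj hH hU, hD, hq, hr, vNEntropy_diagonal, vNEntropy_diagonal,
    vNEntropy_diagonal]
  refine sum_entropy_le_of_bistochastic (fun p c => Complex.normSq (U p c)) _ q r
    (fun p c => Complex.normSq_nonneg _) hρ.1.eigenvalues_nonneg ?_ ?_ hsum ?_ ?_
  · intro p
    have h := congrFun (congrFun hU p) p
    rw [one_apply_eq, mul_apply] at h
    apply Complex.ofReal_injective
    rw [Complex.ofReal_sum, Complex.ofReal_one, ← h]
    simp [← Complex.mul_conj]
  · intro p
    have h := congrFun (congrFun hU' p) p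
    rw [one_apply_eq, mul_apply] at h
    apply Complex.ofReal_injective
    rw [Complex.ofReal_sum, Complex.ofReal_one, ← h]
    exact Finset.sum_congr rfl fun c _ => by
      rw [← Complex.mul_conj, mul_comm]; rfl
  · intro a
    have h := congrFun (congrFun hq a) a
    apply Complex.ofReal_injective
    rw [diagonal_apply_eq] at h
    rw [← h, Complex.ofReal_sum, ptrace2]
    exact Finset.sum_congr rfl fun b _ => hdiag (a, b)
  · intro b
    have h := congrFun (congrFun hr b) b
    apply Complex.ofReal_injective
    rw [diagonal_apply_eq] at h
    rw [← h, Complex.ofReal_sum, ptrace1]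
    exact Finset.sum_congr rfl fun a _ => hdiag (a, b)

theorem ptrace2_conj_kronecker {m n : Type*} [Fintype m] [Fintype n] [DecidableEq n]
    (ρ : Matrix (m × n) (m × n) ℂ) (A : Matrix m m ℂ) {B : Matrix n n ℂ} (hB : B * Bᴴ = 1) :
    ptrace2 ((A ⊗ₖ B)ᴴ * ρ * (A ⊗ₖ B)) = Aᴴ * ptrace2 ρ * A := by
  ext a a'
  let blk : m → m → Matrix n n ℂ := fun x y => Matrix.of fun j j' => ρ (x, j) (y, j')
  have hblk : ∀ x y, (Bᴴ * blk x y * B).trace = ptrace2 ρ x y := by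
    intro x y
    rw [trace_mul_comm, ← mul_assoc, hB, one_mul]
    rfl
  have hentry : ∀ b, ((A ⊗ₖ B)ᴴ * ρ * (A ⊗ₖ B)) (a, b) (a', b) =
      ∑ y, ∑ x, star (A x a) * A y a' * (Bᴴ * blk x y * B) b b := by
    intro b
    simp only [mul_apply, Fintype.sum_prod_type, conjTranspose_apply, kroneckerMap_apply,
      Finset.sum_mul, Finset.mul_sum, star_mul']
    refine Finset.sum_congr rfl fun y _ => ?_
    rw [Finset.sum_comm]
    refine Finset.sum_congr rfl fun x _ => Finset.sum_congr rfl fun j _ =>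
      Finset.sum_congr rfl fun j' _ => ?_
    simp only [blk, of_apply]
    ring
  simp only [ptrace2, of_apply] at hblk ⊢
  simp_rw [hentry]
  rw [Finset.sum_comm]
  simp only [mul_apply, Finset.sum_mul, conjTranspose_apply, of_apply]
  refine Finset.sum_congr rfl fun y _ => ?_
  rw [Finset.sum_comm]
  refine Finset.sum_congr rfl fun x _ => ?_
  rw [← Finset.mul_sum, ← hblk x y, trace]
  simp only [diag_apply, mul_apply, conjTranspose_apply, Finset.sum_mul]
  ring

theorem ptrace1_eq_ptrace2_swap {m n : Type*} [Fintype m] (ρ : Matrix (m × n) (m × n) ℂ) :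
    ptrace1 ρ = ptrace2 (ρ.submatrix (Equiv.prodComm n m) (Equiv.prodComm n m)) := rfl

theorem ptrace1_conj_kronecker {m n : Type*} [Fintype m] [Fintype n] [DecidableEq m]
    (ρ : Matrix (m × n) (m × n) ℂ) {A : Matrix m m ℂ} (B : Matrix n n ℂ) (hA : A * Aᴴ = 1) :
    ptrace1 ((A ⊗ₖ B)ᴴ * ρ * (A ⊗ₖ B)) = Bᴴ * ptrace1 ρ * B := by
  have hAB : (A ⊗ₖ B).submatrix (Equiv.prodComm n m) (Equiv.prodComm n m) = B ⊗ₖ A := by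
    ext i j
    exact mul_comm _ _
  rw [ptrace1_eq_ptrace2_swap, ptrace1_eq_ptrace2_swap, ← ptrace2_conj_kronecker _ _ hA,
    ← submatrix_mul_equiv _ _ _ (Equiv.prodComm n m) _,
    ← submatrix_mul_equiv _ _ _ (Equiv.prodComm n m) _, ← conjTranspose_submatrix, hAB]

theorem isHermitian_ptrace2 {m n : Type*} [Fintype n] {ρ : Matrix (m × n) (m × n) ℂ}
    (hρ : ρ.IsHermitian) : (ptrace2 ρ).IsHermitian := by
  ext i j
  simp only [conjTranspose_apply, ptrace2, of_apply, star_sum]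
  exact Finset.sum_congr rfl fun b _ => hρ.apply _ _

theorem isHermitian_ptrace1 {m n : Type*} [Fintype m] {ρ : Matrix (m × n) (m × n) ℂ}
    (hρ : ρ.IsHermitian) : (ptrace1 ρ).IsHermitian :=
  isHermitian_ptrace2 (hρ.submatrix (Equiv.prodComm n m))

/-- **Subadditivity** of the von Neumann entropy. -/
theorem vNEntropy_le_ptrace_add_ptrace {m n : Type*} [Fintype m] [DecidableEq m] [Fintype n]
    [DecidableEq n] {ρ : Matrix (m × n) (m × n) ℂ} (hρ : IsDensity ρ) :
    vNEntropy ρ ≤ vNEntropy (ptrace2 ρ) + vNEntropy (ptrace1 ρ) := by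
  have hH := hρ.1.isHermitian
  obtain ⟨A, hA, hA', hDA⟩ := exists_unitary_conj_eq_diagonal (isHermitian_ptrace2 hH)
  obtain ⟨B, hB, hB', hDB⟩ := exists_unitary_conj_eq_diagonal (isHermitian_ptrace1 hH)
  have hW : (A ⊗ₖ B) * (A ⊗ₖ B)ᴴ = 1 := by
    rw [conjTranspose_kronecker, ← mul_kronecker_mul, hA, hB, one_kronecker_one]
  have hρ' : IsDensity ((A ⊗ₖ B)ᴴ * ρ * (A ⊗ₖ B)) := by
    refine ⟨hρ.1.conjTranspose_mul_mul_same _, ?_⟩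
    rw [trace_mul_comm, ← mul_assoc, hW, one_mul, hρ.2]
  have h2 := ptrace2_conj_kronecker ρ A hB
  have h1 := ptrace1_conj_kronecker ρ B hA
  have h := vNEntropy_le_of_ptrace_eq_diagonal hρ' (h2.trans hDA) (h1.trans hDB)
  rwa [h2, h1, vNEntropy_conj hH hW, vNEntropy_conj (isHermitian_ptrace2 hH) hA,
    vNEntropy_conj (isHermitian_ptrace1 hH) hB] at h

/-- If a pure state on `R ⊗ I ⊗ A ⊗ B` (with `R` maximally mixed of dimension `d`) has the product
marginal `1/d ⊗ σA` on `R ⊗ A`, then `log₂ d + S(A) ≤ S(I) + S(B)`. -/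
theorem logb_add_vNEntropy_le {I A B : Type*} [Fintype I] [DecidableEq I] [Fintype A]
    [DecidableEq A] [Fintype B] [DecidableEq B] {d : ℕ} (hd : d ≠ 0)
    (T : I → A → B → Fin d → ℂ) {σA : Matrix A A ℂ} {σB : Matrix B B ℂ} {τ : Matrix I I ℂ}
    (hσA : IsDensity σA)
    (hA : ∀ a a' x y, ∑ i, ∑ b, T i a b x * star (T i a' b y) = if x = y then σA a a' else 0)
    (hB : ∀ b b' x, ∑ i, ∑ a, T i a b x * star (T i a b' x) = σB b b')
    (hτ : ∀ i i', τ i i' = (d : ℂ)⁻¹ * ∑ x, ∑ a, ∑ b, T i a b x * star (T i' a b x)) :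
    Real.logb 2 d + vNEntropy σA ≤ vNEntropy τ + vNEntropy σB := by
  have hd' : (d : ℂ) ≠ 0 := by exact_mod_cast hd
  obtain ⟨s, hs⟩ : ∃ s : ℂ, s * star s = (d : ℂ)⁻¹ := by
    refine ⟨((Real.sqrt (d : ℝ)⁻¹ : ℝ) : ℂ), ?_⟩
    rw [Complex.star_def, Complex.conj_ofReal, ← Complex.ofReal_mul,
      Real.mul_self_sqrt (by positivity)]
    simp
  have hterm : ∀ u v : ℂ, s * u * (star s * star v) = (d : ℂ)⁻¹ * (u * star v) := by
    intro u v
    rw [← hs]; ring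
  let Φ : Matrix (I × B) (Fin d × A) ℂ := Matrix.of fun p q => s * T p.1 q.2 p.2 q.1
  have hΦ : (Φᴴ * Φ)ᵀ = (d : ℂ)⁻¹ • ((1 : Matrix (Fin d) (Fin d) ℂ) ⊗ₖ σA) := by
    ext ⟨x, a⟩ ⟨y, a'⟩
    simp only [transpose_apply, mul_apply, conjTranspose_apply, Φ, of_apply, star_mul',
      Fintype.sum_prod_type, Matrix.smul_apply, kroneckerMap_apply, smul_eq_mul, one_apply,
      ite_mul, one_mul, zero_mul, ← hA a a' x y, Finset.mul_sum]
    exact Finset.sum_congr rfl fun i _ => Finset.sum_congr rfl fun b _ => by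
      rw [mul_comm, hterm]
  have hdens : IsDensity (Φ * Φᴴ) := by
    refine ⟨posSemidef_self_mul_conjTranspose Φ, ?_⟩
    rw [trace_mul_comm, ← trace_transpose, hΦ, trace_smul, trace_kronecker, hσA.2]
    simp [hd']
  have h2 : ptrace2 (Φ * Φᴴ) = τ := by
    ext i i'
    simp only [ptrace2, of_apply, mul_apply, conjTranspose_apply, Φ, star_mul',
      Fintype.sum_prod_type, hτ, hterm, Finset.mul_sum]
    rw [Finset.sum_comm]
    exact Finset.sum_congr rfl fun x _ => Finset.sum_comm
  have h1 : ptrace1 (Φ * Φᴴ) = σB := by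
    ext b b'
    simp only [ptrace1, of_apply, mul_apply, conjTranspose_apply, Φ, star_mul',
      Fintype.sum_prod_type, hterm]
    rw [Finset.sum_comm]
    simp only [← Finset.mul_sum, hB]
    simp [hd']
  have h := vNEntropy_le_ptrace_add_ptrace hdens
  rwa [h1, h2, vNEntropy_mul_conjTranspose_comm,
    ← vNEntropy_transpose (isHermitian_conjTranspose_mul_self Φ), hΦ,
    vNEntropy_maximallyMixed_kronecker hd hσA] at h

/-- The index of the whole system with prescribed restrictions to three sets of factors covering
all of them. -/
def glue {P : Type*} [DecidableEq P] {dim : P → ℕ} {S T U : Finset P}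
    (hcov : ∀ p, p ∈ S ∨ p ∈ T ∨ p ∈ U) (x : ∀ p : {p // p ∈ S}, Fin (dim p.1))
    (y : ∀ p : {p // p ∈ T}, Fin (dim p.1)) (z : ∀ p : {p // p ∈ U}, Fin (dim p.1)) :
    ∀ p, Fin (dim p) := fun p =>
  if hS : p ∈ S then x ⟨p, hS⟩ else if hT : p ∈ T then y ⟨p, hT⟩
  else z ⟨p, ((hcov p).resolve_left hS).resolve_left hT⟩

section glue

variable {P : Type*} [DecidableEq P] {dim : P → ℕ} {S T U : Finset P}

theorem glue_swap_left (hcov : ∀ p, p ∈ S ∨ p ∈ T ∨ p ∈ U) (hcov' : ∀ p, p ∈ T ∨ p ∈ S ∨ p ∈ U)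
    (hST : Disjoint S T) (x : ∀ p : {p // p ∈ S}, Fin (dim p.1))
    (y : ∀ p : {p // p ∈ T}, Fin (dim p.1)) (z : ∀ p : {p // p ∈ U}, Fin (dim p.1)) :
    glue hcov' y x z = glue hcov x y z := by
  funext p
  by_cases hS : p ∈ S
  · have hT := Finset.disjoint_left.1 hST hS
    simp [glue, hS, hT]
  · simp [glue, hS]

theorem glue_swap_right (hcov : ∀ p, p ∈ S ∨ p ∈ T ∨ p ∈ U) (hcov' : ∀ p, p ∈ S ∨ p ∈ U ∨ p ∈ T)
    (hTU : Disjoint T U) (x : ∀ p : {p // p ∈ S}, Fin (dim p.1))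
    (y : ∀ p : {p // p ∈ T}, Fin (dim p.1)) (z : ∀ p : {p // p ∈ U}, Fin (dim p.1)) :
    glue hcov' x z y = glue hcov x y z := by
  funext p
  by_cases hS : p ∈ S
  · simp [glue, hS]
  · by_cases hT : p ∈ T
    · have hU := Finset.disjoint_left.1 hTU hT
      simp [glue, hS, hT, hU]
    · have hU : p ∈ U := ((hcov p).resolve_left hS).resolve_left hT
      simp [glue, hS, hT, hU]

variable [Fintype P]

theorem reduced_apply_eq_sum_glue (hcov : ∀ p, p ∈ S ∨ p ∈ T ∨ p ∈ U)
    (hST : Disjoint S T) (hSU : Disjoint S U) (hTU : Disjoint T U)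
    (M : Matrix (∀ p, Fin (dim p)) (∀ p, Fin (dim p)) ℂ)
    (x x' : ∀ p : {p // p ∈ S}, Fin (dim p.1)) :
    reduced S M x x' = ∑ y : ∀ p : {p // p ∈ T}, Fin (dim p.1),
      ∑ z : ∀ p : {p // p ∈ U}, Fin (dim p.1), M (glue hcov x y z) (glue hcov x' y z) := by
  have hT : ∀ p : {p // p ∈ T}, p.1 ∉ S := fun p => Finset.disjoint_right.1 hST p.2
  have hU : ∀ p : {p // p ∈ U}, p.1 ∉ S := fun p => Finset.disjoint_right.1 hSU p.2
  let e : (∀ p : {p // p ∉ S}, Fin (dim p.1)) ≃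
      (∀ p : {p // p ∈ T}, Fin (dim p.1)) × (∀ p : {p // p ∈ U}, Fin (dim p.1)) :=
    { toFun := fun w => (fun p => w ⟨p.1, hT p⟩, fun p => w ⟨p.1, hU p⟩)
      invFun := fun yz p => if h : p.1 ∈ T then yz.1 ⟨p.1, h⟩
        else yz.2 ⟨p.1, ((hcov p.1).resolve_left p.2).resolve_left h⟩
      left_inv := fun w => by
        funext p
        by_cases h : p.1 ∈ T <;> simp [h]
      right_inv := fun yz => by
        refine Prod.ext ?_ ?_
        · funext p
          simp [p.2]
        · funext p
          simp [Finset.disjoint_right.1 hTU p.2] }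
  rw [← Fintype.sum_prod_type (f := fun yz : (∀ p : {p // p ∈ T}, Fin (dim p.1)) ×
    (∀ p : {p // p ∈ U}, Fin (dim p.1)) => M (glue hcov x yz.1 yz.2) (glue hcov x' yz.1 yz.2))]
  exact (Equiv.sum_comp e.symm _).symm


end glue

theorem trace_reduced {P : Type*} [Fintype P] [DecidableEq P] {dim : P → ℕ} (S : Finset P)
    (M : Matrix (∀ p, Fin (dim p)) (∀ p, Fin (dim p)) ℂ) : (reduced S M).trace = M.trace := by
  let e := Equiv.piEquivPiSubtypeProd (fun p => p ∈ S) fun p => Fin (dim p)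
  rw [trace, trace, ← Equiv.sum_comp e.symm, Fintype.sum_prod_type]
  rfl

theorem reduced_add {P : Type*} [Fintype P] [DecidableEq P] {dim : P → ℕ} (S : Finset P)
    (M N : Matrix (∀ p, Fin (dim p)) (∀ p, Fin (dim p)) ℂ) :
    reduced S (M + N) = reduced S M + reduced S N := by
  ext x y
  simp [reduced, Finset.sum_add_distrib]

theorem reduced_smul {P : Type*} [Fintype P] [DecidableEq P] {dim : P → ℕ} (S : Finset P) (c : ℂ)
    (M : Matrix (∀ p, Fin (dim p)) (∀ p, Fin (dim p)) ℂ) :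
    reduced S (c • M) = c • reduced S M := by
  ext x y
  simp [reduced, Finset.mul_sum]

theorem Matrix.PosSemidef.reduced {P : Type*} [Fintype P] [DecidableEq P] {dim : P → ℕ}
    (S : Finset P) {M : Matrix (∀ p, Fin (dim p)) (∀ p, Fin (dim p)) ℂ} (hM : M.PosSemidef) :
    (_root_.reduced S M).PosSemidef := by
  have h : _root_.reduced S M = ∑ z : ∀ p : {p // p ∉ S}, Fin (dim p.1),
      M.submatrix (fun x p => if h : p ∈ S then x ⟨p, h⟩ else z ⟨p, h⟩)
        (fun x p => if h : p ∈ S then x ⟨p, h⟩ else z ⟨p, h⟩) := by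
    ext x y
    simp [_root_.reduced, Matrix.sum_apply]
  rw [h]
  exact posSemidef_sum _ fun z _ => hM.submatrix _

theorem vecMulVec_single_single {m n α : Type*} [DecidableEq m] [DecidableEq n] [MulZeroClass α]
    (i : m) (j : n) (a b : α) :
    vecMulVec (Pi.single i a) (Pi.single j b) = Matrix.single i j (a * b) := by
  ext i' j'
  simp only [vecMulVec_apply, Matrix.single_apply, Pi.single_apply]
  split_ifs <;> simp_all

theorem mul_single_mul_conjTranspose_apply {m n : Type*} [Fintype n] [DecidableEq n]
    (V : Matrix m n ℂ) (x y : n) (p q : m) :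
    (V * Matrix.single x y (1 : ℂ) * Vᴴ) p q = V p x * star (V q y) := by
  rw [single_eq_single_vecMulVec_single, mul_vecMulVec, vecMulVec_mul]
  simp [vecMulVec_apply]

/-- A linear map on matrices that takes one and the same value on all density matrices is a
multiple of the trace on matrix units. -/
theorem map_single_eq_of_const_on_density {n E : Type*} [Fintype n] [DecidableEq n]
    [AddCommGroup E] [Module ℂ E] (f : Matrix n n ℂ →ₗ[ℂ] E) (s : E)
    (hf : ∀ ρ, IsDensity ρ → f ρ = s) (x y : n) :
    f (Matrix.single x y 1) = if x = y then s else 0 := by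
  have hdiag : ∀ x, f (Matrix.single x x 1) = s := by
    intro x
    refine hf _ ⟨?_, by simp⟩
    have h := posSemidef_vecMulVec_self_star (Pi.single x (1 : ℂ))
    rwa [Pi.star_single, star_one, vecMulVec_single_single, mul_one] at h
  split_ifs with hxy
  · subst hxy; exact hdiag x
  have hoff : ∀ c : ℂ, c * star c = 1 →
      star c • f (Matrix.single x y 1) + c • f (Matrix.single y x 1) = 0 := by
    intro c hc
    let v : n → ℂ := Pi.single x 1 + Pi.single y c
    have hv : vecMulVec v (star v) = Matrix.single x x 1 + Matrix.single y y 1 +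
        (star c • Matrix.single x y 1 + c • Matrix.single y x 1) := by
      simp only [v, star_add, Pi.star_single, star_one, vecMulVec_add, add_vecMulVec,
        vecMulVec_single_single, smul_single, smul_eq_mul, mul_one, one_mul, hc]
      abel
    have hd : IsDensity ((2⁻¹ : ℂ) • vecMulVec v (star v)) := by
      refine ⟨(posSemidef_vecMulVec_self_star v).smul (by norm_num [Complex.le_def]), ?_⟩
      rw [hv]
      simp [trace_single_eq_of_ne _ _ _ hxy, trace_single_eq_of_ne _ _ _ (Ne.symm hxy)]
      norm_num
    have h := hf _ hd
    rw [hv, map_smul, map_add, map_add, map_add, map_smul, map_smul, hdiag, hdiag] at h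
    have h2 := congrArg (fun t => (2 : ℂ) • t) h
    simp only [smul_smul] at h2
    norm_num at h2
    rw [two_smul] at h2
    simpa using h2
  have h1 := hoff 1 (by simp)
  have h2 := hoff Complex.I (by simp)
  rw [star_one, one_smul, one_smul] at h1
  rw [eq_neg_of_add_eq_zero_right h1, smul_neg, ← sub_eq_add_neg, ← sub_smul] at h2
  refine (smul_eq_zero.1 h2).resolve_left fun h => ?_
  have := congrArg Complex.im h
  norm_num at this
/-- If the marginal on `S` of an encoding `V` does not depend on the encoded state, then neither
does it on the encoded matrix unit, up to its trace. -/
theorem reduced_single_of_secret {P : Type*} [Fintype P] [DecidableEq P] {dim : P → ℕ} {n : Type*}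
    [Fintype n] [DecidableEq n] (V : Matrix (∀ p, Fin (dim p)) n ℂ) {S : Finset P}
    (hS : ∀ ρ ρ' : Matrix n n ℂ, IsDensity ρ → IsDensity ρ' →
      reduced S (V * ρ * Vᴴ) = reduced S (V * ρ' * Vᴴ))
    {ρ : Matrix n n ℂ} (hρ : IsDensity ρ) (x y : n) :
    reduced S (V * Matrix.single x y (1 : ℂ) * Vᴴ) =
      if x = y then reduced S (V * ρ * Vᴴ) else 0 := by
  let f : Matrix n n ℂ →ₗ[ℂ] Matrix (∀ p : {p // p ∈ S}, Fin (dim p.1))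
      (∀ p : {p // p ∈ S}, Fin (dim p.1)) ℂ :=
    { toFun := fun X => reduced S (V * X * Vᴴ)
      map_add' := fun X Y => by rw [Matrix.mul_add, Matrix.add_mul, reduced_add]
      map_smul' := fun c X => by
        rw [Matrix.mul_smul, Matrix.smul_mul, reduced_smul, RingHom.id_apply] }
  exact map_single_eq_of_const_on_density f _ (fun ρ' hρ' => hS ρ' ρ hρ' hρ) x y

theorem sum_glue_of_secret {P : Type*} [Fintype P] [DecidableEq P] {dim : P → ℕ} {n : Type*}
    [Fintype n] [DecidableEq n] (V : Matrix (∀ p, Fin (dim p)) n ℂ) {S T U : Finset P}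
    (hcov : ∀ p, p ∈ S ∨ p ∈ T ∨ p ∈ U)
    (hST : Disjoint S T) (hSU : Disjoint S U) (hTU : Disjoint T U)
    (hS : ∀ ρ ρ' : Matrix n n ℂ, IsDensity ρ → IsDensity ρ' →
      reduced S (V * ρ * Vᴴ) = reduced S (V * ρ' * Vᴴ))
    {ρ : Matrix n n ℂ} (hρ : IsDensity ρ) (a a' : ∀ p : {p // p ∈ S}, Fin (dim p.1)) (x y : n) :
    ∑ b, ∑ c, V (glue hcov a b c) x * star (V (glue hcov a' b c) y) =
      if x = y then reduced S (V * ρ * Vᴴ) a a' else 0 := by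
  have h := congrFun (congrFun (reduced_single_of_secret V hS hρ x y) a) a'
  rw [reduced_apply_eq_sum_glue hcov hST hSU hTU] at h
  simp only [mul_single_mul_conjTranspose_apply] at h
  rw [h]
  split_ifs <;> rfl

/-- in a `(k, 2k-1)`-threshold quantum secret sharing scheme hiding a
`d`-dimensional secret, the marginal state of every single party has von Neumann entropy
at least `log₂ d`. -/
theorem qss_marginal_entropy_bound
    (k d : ℕ) (hk : 2 ≤ k) (hd : 2 ≤ d)
    (dim : Fin (2 * k - 1) → ℕ) (hdim : ∀ p, 0 < dim p)
    (V : Matrix (∀ p, Fin (dim p)) (Fin d) ℂ)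
    (hV : Vᴴ * V = 1)
    (hsecret : ∀ U : Finset (Fin (2 * k - 1)), U.card ≤ k - 1 →
      ∀ ρ ρ' : Matrix (Fin d) (Fin d) ℂ, IsDensity ρ → IsDensity ρ' →
        reduced U (V * ρ * Vᴴ) = reduced U (V * ρ' * Vᴴ))
    (i : Fin (2 * k - 1)) (ρ : Matrix (Fin d) (Fin d) ℂ) (hρ : IsDensity ρ) :
    Real.logb 2 d ≤ vNEntropy (reduced ({i} : Finset (Fin (2 * k - 1))) (V * ρ * Vᴴ)) := by
  have hd0 : d ≠ 0 := by omega
  have hdC : (d : ℂ) ≠ 0 := by exact_mod_cast hd0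
  have hcard : (Finset.univ.erase i).card = 2 * k - 2 := by
    rw [Finset.card_erase_of_mem (Finset.mem_univ i), Finset.card_univ, Fintype.card_fin]; omega
  obtain ⟨SA, hSA, hcardA⟩ :=
    Finset.exists_subset_card_eq (s := Finset.univ.erase i) (n := k - 1) (by omega)
  obtain ⟨SB, hSB⟩ : ∃ SB, SB = Finset.univ.erase i \ SA := ⟨_, rfl⟩
  have hcardB : SB.card = k - 1 := by
    rw [hSB, Finset.card_sdiff_of_subset hSA]; omega
  have hmemB : ∀ p, p ∈ SB ↔ p ≠ i ∧ p ∉ SA := fun p => by simp [hSB]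
  have hiA : i ∉ SA := fun h => (Finset.mem_erase.1 (hSA h)).1 rfl
  have hiB : i ∉ SB := fun h => ((hmemB i).1 h).1 rfl
  have disjA : Disjoint {i} SA := Finset.disjoint_singleton_left.2 hiA
  have disjB : Disjoint {i} SB := Finset.disjoint_singleton_left.2 hiB
  have disjAB : Disjoint SA SB :=
    Finset.disjoint_left.2 fun p hp hp' => ((hmemB p).1 hp').2 hp
  have hcov : ∀ p, p ∈ ({i} : Finset _) ∨ p ∈ SA ∨ p ∈ SB := fun p => by
    rw [hmemB, Finset.mem_singleton]; tauto
  have hcovI : ∀ p, p ∈ ({i} : Finset _) ∨ p ∈ SB ∨ p ∈ SA := fun p => (hcov p).imp_right Or.symm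
  have hcovA : ∀ p, p ∈ SA ∨ p ∈ ({i} : Finset _) ∨ p ∈ SB := fun p => or_left_comm.1 (hcov p)
  have hcovB : ∀ p, p ∈ SB ∨ p ∈ ({i} : Finset _) ∨ p ∈ SA := fun p => or_left_comm.1 (hcovI p)
  have hdens : ∀ S, IsDensity (reduced S (V * ρ * Vᴴ)) := fun S =>
    ⟨(hρ.1.mul_mul_conjTranspose_same V).reduced S, by
      rw [trace_reduced, trace_mul_comm, ← Matrix.mul_assoc, hV, Matrix.one_mul, hρ.2]⟩
  have hA : ∀ a a' x y, ∑ j, ∑ b, V (glue hcov j a b) x * star (V (glue hcov j a' b) y) =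
      if x = y then reduced SA (V * ρ * Vᴴ) a a' else 0 := by
    intro a a' x y
    rw [← sum_glue_of_secret V hcovA disjA.symm disjAB disjB (hsecret SA hcardA.le) hρ a a' x y]
    simp only [glue_swap_left hcov hcovA disjA]
  have hB : ∀ b b' x y, ∑ j, ∑ a, V (glue hcov j a b) x * star (V (glue hcov j a b') y) =
      if x = y then reduced SB (V * ρ * Vᴴ) b b' else 0 := by
    intro b b' x y
    rw [← sum_glue_of_secret V hcovB disjB.symm disjAB.symm disjA (hsecret SB hcardB.le) hρ b b' x y]
    simp only [glue_swap_left hcovI hcovB disjB, glue_swap_right hcov hcovI disjAB]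
  have hI : ∀ j j', reduced {i} (V * ρ * Vᴴ) j j' =
      (d : ℂ)⁻¹ * ∑ x, ∑ a, ∑ b, V (glue hcov j a b) x * star (V (glue hcov j' a b) x) := by
    intro j j'
    simp_rw [sum_glue_of_secret V hcov disjA disjB disjAB
      (hsecret {i} (by rw [Finset.card_singleton]; omega)) hρ j j']
    simp [hdC]
  have h1 := logb_add_vNEntropy_le hd0 (fun j a b x => V (glue hcov j a b) x) (hdens SA) hA
    (fun b b' x => (hB b b' x x).trans (if_pos rfl)) hI
  have h2 := logb_add_vNEntropy_le hd0 (fun j b a x => V (glue hcov j a b) x) (hdens SB) hB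
    (fun a a' x => (hA a a' x x).trans (if_pos rfl)) fun j j' =>
      (hI j j').trans (congrArg _ (Finset.sum_congr rfl fun x _ => Finset.sum_comm))
  linarith

end
end

section
/- For every d ≥ 2 there exists a universal quantum masker for d-dimensional states whose safe state has von Neumann entropy exactly log₂ d: there exist positive integers s, d_A, d_B with d·s = d_A·d_B, a unitary M from ℂ^d⊗ℂ^s to ℂ^{d_A}⊗ℂ^{d_B}, and a density matrix ω on ℂ^s with S(ω) = log₂ d, such that (M, ω) is a universal quantum masker for d-dimensional states. -/
open Matrix Kronecker
open scoped ComplexOrder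

noncomputable section

/-- The entropy of a normalized projection: if `c • ρ` is idempotent and `ρ` is a density matrix,
then `ρ` has entropy `log₂ c`. -/
theorem vNEntropy_eq_logb_of_mul_self {n : Type*} [Fintype n] [DecidableEq n]
    {ρ : Matrix n n ℂ} (hρ : IsDensity ρ) {c : ℝ}
    (h : ρ * ρ = ((c⁻¹ : ℝ) : ℂ) • ρ) : vNEntropy ρ = Real.logb 2 c := by
  have hH : ρ.IsHermitian := hρ.1.isHermitian
  have hev (i : n) : hH.eigenvalues i * hH.eigenvalues i = c⁻¹ * hH.eigenvalues i := by
    have hv := hH.mulVec_eigenvectorBasis i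
    have hne : (hH.eigenvectorBasis i).ofLp ≠ 0 := fun h0 =>
      hH.eigenvectorBasis.orthonormal.ne_zero i (by ext k; simpa using congrFun h0 k)
    have h2 := congrArg (fun A => A *ᵥ (hH.eigenvectorBasis i).ofLp) h
    simp only [← Matrix.mulVec_mulVec, Matrix.smul_mulVec, hv, Matrix.mulVec_smul] at h2
    obtain ⟨k, hk⟩ := Function.ne_iff.mp hne
    have h3 := congrFun h2 k
    simp only [Pi.smul_apply, Complex.real_smul, smul_eq_mul, ← mul_assoc] at h3
    exact_mod_cast mul_right_cancel₀ hk h3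
  have hsum : ∑ i, hH.eigenvalues i = 1 := by
    have := hH.trace_eq_sum_eigenvalues
    rw [hρ.2] at this
    exact_mod_cast (by simpa using this.symm : (∑ i, (hH.eigenvalues i : ℂ)) = 1)
  have hterm (i : n) : hH.eigenvalues i * Real.logb 2 (hH.eigenvalues i)
      = hH.eigenvalues i * -Real.logb 2 c := by
    rcases eq_or_ne (hH.eigenvalues i) 0 with h0 | h0
    · simp [h0]
    · rw [mul_right_cancel₀ h0 (hev i), Real.logb_inv]
  rw [vNEntropy, dif_pos hH, Finset.sum_congr rfl fun i _ => hterm i, ← Finset.sum_mul, hsum]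
  ring

theorem isDensity_inv_smul_one {n : Type*} [Fintype n] [DecidableEq n] {c : ℝ} (hc : 0 < c)
    (hn : (Fintype.card n : ℝ) = c) : IsDensity (((c⁻¹ : ℝ) : ℂ) • (1 : Matrix n n ℂ)) := by
  refine ⟨Matrix.PosSemidef.one.smul ?_, ?_⟩
  · exact_mod_cast (inv_pos.2 hc).le
  · rw [Matrix.trace_smul, Matrix.trace_one, smul_eq_mul, ← Complex.ofReal_natCast, hn,
      ← Complex.ofReal_mul, inv_mul_cancel₀ hc.ne', Complex.ofReal_one]

theorem mul_kronecker_diagonal_mul_conjTranspose_apply {I S P : Type*}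
    [Fintype I] [Fintype S] [DecidableEq S]
    (M : Matrix P (I × S) ℂ) (ρ : Matrix I I ℂ) (w : S → ℂ) (p p' : P) :
    (M * (ρ ⊗ₖ diagonal w) * Mᴴ) p p'
      = ∑ i, ∑ i', ρ i i' * ∑ s, w s * (M p (i, s) * star (M p' (i', s))) := by
  simp only [Matrix.mul_apply, Fintype.sum_prod_type, kroneckerMap_apply, diagonal_apply,
    mul_ite, mul_zero, Finset.sum_ite_eq', Finset.mem_univ, if_true,
    conjTranspose_apply, Finset.sum_mul, Finset.mul_sum]
  rw [Finset.sum_comm (s := Finset.univ (α := I)) (t := Finset.univ (α := I))]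
  refine Finset.sum_congr rfl fun i' _ => ?_
  rw [Finset.sum_comm]
  exact Finset.sum_congr rfl fun i _ => Finset.sum_congr rfl fun s _ => by ring

section Marginals

variable {I S A B : Type*} [Fintype I] [DecidableEq I] [Fintype S] [DecidableEq S]

theorem ptrace2_eq_of_masking [Fintype B] {M : Matrix (A × B) (I × S) ℂ} {w : S → ℂ}
    {σ : Matrix A A ℂ}
    (h : ∀ i i' a a', ∑ s, w s * ∑ b, M (a, b) (i, s) * star (M (a', b) (i', s))
      = if i = i' then σ a a' else 0)
    {ρ : Matrix I I ℂ} (hρ : IsDensity ρ) :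
    ptrace2 (M * (ρ ⊗ₖ diagonal w) * Mᴴ) = σ := by
  ext a a'
  have key : ptrace2 (M * (ρ ⊗ₖ diagonal w) * Mᴴ) a a' = ∑ i, ∑ i', ρ i i' *
      ∑ s, w s * ∑ b, M (a, b) (i, s) * star (M (a', b) (i', s)) := by
    simp only [ptrace2, Matrix.of_apply, mul_kronecker_diagonal_mul_conjTranspose_apply,
      Finset.mul_sum]
    rw [Finset.sum_comm]
    refine Finset.sum_congr rfl fun i _ => ?_
    rw [Finset.sum_comm]
    exact Finset.sum_congr rfl fun i' _ => Finset.sum_comm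
  have htr : ∑ i, ρ i i = 1 := hρ.2
  simp only [key, h, mul_ite, mul_zero, Finset.sum_ite_eq, Finset.mem_univ, if_true,
    ← Finset.sum_mul, htr, one_mul]

theorem ptrace1_eq_of_masking [Fintype A] {M : Matrix (A × B) (I × S) ℂ} {w : S → ℂ}
    {σ : Matrix B B ℂ}
    (h : ∀ i i' b b', ∑ s, w s * ∑ a, M (a, b) (i, s) * star (M (a, b') (i', s))
      = if i = i' then σ b b' else 0)
    {ρ : Matrix I I ℂ} (hρ : IsDensity ρ) :
    ptrace1 (M * (ρ ⊗ₖ diagonal w) * Mᴴ) = σ := by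
  ext b b'
  have key : ptrace1 (M * (ρ ⊗ₖ diagonal w) * Mᴴ) b b' = ∑ i, ∑ i', ρ i i' *
      ∑ s, w s * ∑ a, M (a, b) (i, s) * star (M (a, b') (i', s)) := by
    simp only [ptrace1, Matrix.of_apply, mul_kronecker_diagonal_mul_conjTranspose_apply,
      Finset.mul_sum]
    rw [Finset.sum_comm]
    refine Finset.sum_congr rfl fun i _ => ?_
    rw [Finset.sum_comm]
    exact Finset.sum_congr rfl fun i' _ => Finset.sum_comm
  have htr : ∑ i, ρ i i = 1 := hρ.2
  simp only [key, h, mul_ite, mul_zero, Finset.sum_ite_eq, Finset.mem_univ, if_true,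
    ← Finset.sum_mul, htr, one_mul]

end Marginals

section Hexagon

variable (d : ℕ) [NeZero d]

/-- The encoding `|i⟩|j,k,l⟩ ↦ d⁻¹ ∑_{x,y} χ(i(x+y)+ly) |j+y,x⟩|y,j+k+x⟩`, with `χ` the standard
additive character of `ℤ/d`. For `k = l = 0` it is, up to local Fourier transforms, the graph
state of the hexagon. -/
def hexagonEncoding : Matrix ((ZMod d × ZMod d) × (ZMod d × ZMod d))
    (ZMod d × (ZMod d × (ZMod d × ZMod d))) ℂ :=
  Matrix.of fun r c =>
    (if r.1.1 = c.2.1 + r.2.1 ∧ r.2.2 = c.2.1 + c.2.2.1 + r.1.2 then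
      (d : ℂ)⁻¹ * ZMod.stdAddChar (c.1 * (r.1.2 + r.2.1) + c.2.2.2 * r.2.1) else 0)

/-- The spectrum of the safe state: uniform on the indices `(j, 0, 0)`. -/
def safeWeight (t : ZMod d × (ZMod d × ZMod d)) : ℂ :=
  if t.2 = 0 then (((d : ℝ)⁻¹ : ℝ) : ℂ) else 0

variable {d}

theorem sum_stdAddChar_mul (b : ZMod d) :
    ∑ x : ZMod d, (ZMod.stdAddChar (b * x) : ℂ) = if b = 0 then (d : ℂ) else 0 := by
  have h := AddChar.sum_mulShift b (ZMod.isPrimitive_stdAddChar d)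
  simp only [mul_comm b]
  simpa [ZMod.card] using h

theorem stdAddChar_mul_star (a b : ZMod d) :
    (ZMod.stdAddChar a : ℂ) * star (ZMod.stdAddChar b : ℂ) = ZMod.stdAddChar (a - b) := by
  rw [sub_eq_add_neg, AddChar.map_add_eq_mul, AddChar.map_neg_eq_conj, starRingEnd_apply]

theorem hexagonEncoding_conjTranspose_mul_self :
    (hexagonEncoding d)ᴴ * hexagonEncoding d = 1 := by
  have hd : (d : ℂ) ≠ 0 := Nat.cast_ne_zero.2 (NeZero.ne d)
  ext ⟨i, j, k, l⟩ ⟨i', j', k', l'⟩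
  have inner (x y : ZMod d) : ∑ p, ∑ q,
      hexagonEncoding d ((p, x), (y, q)) (i', j', k', l')
        * star (hexagonEncoding d ((p, x), (y, q)) (i, j, k, l))
      = if j = j' ∧ k = k' then (d : ℂ)⁻¹ * (d : ℂ)⁻¹ * (ZMod.stdAddChar ((i' - i) * x)
          * ZMod.stdAddChar ((i' - i + (l' - l)) * y)) else 0 := by
    have hphase : (ZMod.stdAddChar ((i' - i) * x) : ℂ)
          * ZMod.stdAddChar ((i' - i + (l' - l)) * y)
        = ZMod.stdAddChar (i' * (x + y) + l' * y)
          * star (ZMod.stdAddChar (i * (x + y) + l * y) : ℂ) := by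
      rw [stdAddChar_mul_star, ← AddChar.map_add_eq_mul]
      ring_nf
    rw [hphase]
    rcases eq_or_ne j j' with rfl | hj
    · rcases eq_or_ne k k' with rfl | hk
      · simp [hexagonEncoding, ite_and, apply_ite star]
        ring
      · simp [hexagonEncoding, ite_and, apply_ite star, hk]
    · simp [hexagonEncoding, ite_and, apply_ite star, hj]
  have expand : ((hexagonEncoding d)ᴴ * hexagonEncoding d) (i, j, k, l) (i', j', k', l')
      = ∑ x, ∑ y, ∑ p, ∑ q, hexagonEncoding d ((p, x), (y, q)) (i', j', k', l')
        * star (hexagonEncoding d ((p, x), (y, q)) (i, j, k, l)) := by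
    simp only [Matrix.mul_apply, conjTranspose_apply, Fintype.sum_prod_type]
    rw [Finset.sum_comm]
    refine Finset.sum_congr rfl fun x _ => ?_
    rw [Finset.sum_comm]
    simp only [mul_comm]
  simp only [expand, inner]
  by_cases hjk : j = j' ∧ k = k'
  · simp only [if_pos hjk, ← Finset.mul_sum, ← Finset.sum_mul, sum_stdAddChar_mul]
    obtain ⟨rfl, rfl⟩ := hjk
    rcases eq_or_ne i i' with rfl | hi
    · rcases eq_or_ne l l' with rfl | hl
      · simp
        field_simp
      · simp [hl, sub_eq_zero, hl.symm]
    · simp [hi, sub_eq_zero, hi.symm]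
  · have : ((i, j, k, l) : ZMod d × ZMod d × ZMod d × ZMod d) ≠ (i', j', k', l') := by
      simp only [ne_eq, Prod.mk.injEq]
      tauto
    simp [hjk, Matrix.one_apply_ne this]

theorem sum_safeWeight_mul (f : ZMod d × (ZMod d × ZMod d) → ℂ) :
    ∑ t, safeWeight d t * f t = (d : ℂ)⁻¹ * ∑ j, f (j, 0) := by
  simp [safeWeight, Fintype.sum_prod_type (α₁ := ZMod d) (α₂ := ZMod d × ZMod d), ite_mul,
    Finset.mul_sum]

theorem hexagonEncoding_marginal_fst (i i' : ZMod d) (a a' : ZMod d × ZMod d) :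
    ∑ t, safeWeight d t * ∑ b, hexagonEncoding d (a, b) (i, t)
        * star (hexagonEncoding d (a', b) (i', t))
      = if i = i' then ((((d : ℝ) ^ 2)⁻¹ : ℝ) : ℂ) * (if a = a' then 1 else 0) else 0 := by
  have hd : (d : ℂ) ≠ 0 := Nat.cast_ne_zero.2 (NeZero.ne d)
  obtain ⟨p, x⟩ := a
  obtain ⟨p', x'⟩ := a'
  rw [sum_safeWeight_mul]
  by_cases ha : (p, x) = (p', x')
  · obtain ⟨rfl, rfl⟩ := Prod.mk.inj ha
    have inner (y : ZMod d) : ∑ j, ∑ q, hexagonEncoding d ((p, x), (y, q)) (i, j, 0)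
        * star (hexagonEncoding d ((p, x), (y, q)) (i', j, 0))
        = (d : ℂ)⁻¹ * (d : ℂ)⁻¹ * (ZMod.stdAddChar ((i - i') * x)
          * ZMod.stdAddChar ((i - i') * y)) := by
      have hphase : (ZMod.stdAddChar ((i - i') * x) : ℂ) * ZMod.stdAddChar ((i - i') * y)
          = ZMod.stdAddChar (i * (x + y)) * star (ZMod.stdAddChar (i' * (x + y)) : ℂ) := by
        rw [stdAddChar_mul_star, ← AddChar.map_add_eq_mul]
        ring_nf
      rw [hphase]
      have hj (j : ZMod d) : p = j + y ↔ j = p - y := eq_comm.trans eq_sub_iff_add_eq.symm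
      simp [hexagonEncoding, ite_and, apply_ite star, hj]
      ring
    simp only [Fintype.sum_prod_type]
    rw [Finset.sum_comm]
    simp only [inner, ← Finset.mul_sum, sum_stdAddChar_mul, sub_eq_zero]
    rcases eq_or_ne i i' with rfl | hi
    · simp
      field_simp
    · simp [hi]
  · have hzero (j y q : ZMod d) : hexagonEncoding d ((p, x), (y, q)) (i, j, 0)
        * star (hexagonEncoding d ((p', x'), (y, q)) (i', j, 0)) = 0 := by
      by_contra h
      simp only [hexagonEncoding, Matrix.of_apply, mul_eq_zero, star_eq_zero, not_or,
        ite_eq_right_iff, Classical.not_imp] at h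
      obtain ⟨⟨⟨rfl, h1⟩, -⟩, ⟨rfl, h2⟩, -⟩ := h
      exact ha (by rw [add_left_cancel (h1.symm.trans h2)])
    simp only [hzero, ha, Finset.sum_const_zero, if_false, mul_zero, ite_self]

theorem hexagonEncoding_marginal_snd (i i' : ZMod d) (b b' : ZMod d × ZMod d) :
    ∑ t, safeWeight d t * ∑ a, hexagonEncoding d (a, b) (i, t)
        * star (hexagonEncoding d (a, b') (i', t))
      = if i = i' then ((((d : ℝ) ^ 2)⁻¹ : ℝ) : ℂ) * (if b = b' then 1 else 0) else 0 := by
  have hd : (d : ℂ) ≠ 0 := Nat.cast_ne_zero.2 (NeZero.ne d)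
  obtain ⟨y, q⟩ := b
  obtain ⟨y', q'⟩ := b'
  rw [sum_safeWeight_mul]
  by_cases hb : (y, q) = (y', q')
  · obtain ⟨rfl, rfl⟩ := Prod.mk.inj hb
    have inner (x : ZMod d) : ∑ j, ∑ p, hexagonEncoding d ((p, x), (y, q)) (i, j, 0)
        * star (hexagonEncoding d ((p, x), (y, q)) (i', j, 0))
        = (d : ℂ)⁻¹ * (d : ℂ)⁻¹ * (ZMod.stdAddChar ((i - i') * y)
          * ZMod.stdAddChar ((i - i') * x)) := by
      have hphase : (ZMod.stdAddChar ((i - i') * y) : ℂ) * ZMod.stdAddChar ((i - i') * x)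
          = ZMod.stdAddChar (i * (x + y)) * star (ZMod.stdAddChar (i' * (x + y)) : ℂ) := by
        rw [stdAddChar_mul_star, ← AddChar.map_add_eq_mul]
        ring_nf
      rw [hphase]
      have hj (j : ZMod d) : q = j + x ↔ j = q - x := eq_comm.trans eq_sub_iff_add_eq.symm
      simp [hexagonEncoding, ite_and, apply_ite star, hj]
      ring
    have reorder : ∑ j, ∑ a : ZMod d × ZMod d, hexagonEncoding d (a, (y, q)) (i, j, 0)
        * star (hexagonEncoding d (a, (y, q)) (i', j, 0))
        = ∑ x, ∑ j, ∑ p, hexagonEncoding d ((p, x), (y, q)) (i, j, 0)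
          * star (hexagonEncoding d ((p, x), (y, q)) (i', j, 0)) := by
      rw [Finset.sum_comm]
      simp only [Fintype.sum_prod_type]
      rw [Finset.sum_comm]
      exact Finset.sum_congr rfl fun x _ => Finset.sum_comm
    simp only [reorder, inner, ← Finset.mul_sum, sum_stdAddChar_mul, sub_eq_zero]
    rcases eq_or_ne i i' with rfl | hi
    · simp
      field_simp
    · simp [hi]
  · have hzero (j p x : ZMod d) : hexagonEncoding d ((p, x), (y, q)) (i, j, 0)
        * star (hexagonEncoding d ((p, x), (y', q')) (i', j, 0)) = 0 := by
      by_contra h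
      simp only [hexagonEncoding, Matrix.of_apply, mul_eq_zero, star_eq_zero, not_or,
        ite_eq_right_iff, Classical.not_imp] at h
      obtain ⟨⟨⟨h1, rfl⟩, -⟩, ⟨h2, rfl⟩, -⟩ := h
      exact hb (by rw [add_left_cancel (h1.symm.trans h2)])
    simp only [hzero, hb, Finset.sum_const_zero, if_false, mul_zero, ite_self]

theorem isDensity_diagonal_safeWeight : IsDensity (diagonal (safeWeight d)) := by
  have hd : (d : ℂ) ≠ 0 := Nat.cast_ne_zero.2 (NeZero.ne d)
  refine ⟨Matrix.PosSemidef.diagonal fun t => ?_, ?_⟩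
  · change 0 ≤ safeWeight d t
    rw [safeWeight]
    split_ifs
    · exact_mod_cast inv_nonneg.2 (Nat.cast_nonneg (α := ℝ) d)
    · exact le_rfl
  · have h := sum_safeWeight_mul (d := d) 1
    simpa [Matrix.trace_diagonal, ZMod.card, hd] using h

end Hexagon

theorem safeWeight_mul_self {d : ℕ} (t : ZMod d × (ZMod d × ZMod d)) :
    safeWeight d t * safeWeight d t = (((d : ℝ)⁻¹ : ℝ) : ℂ) * safeWeight d t := by
  rw [safeWeight]
  split_ifs <;> simp

theorem IsDensity.submatrix_equiv {m n : Type*} [Fintype m] [Fintype n] {ρ : Matrix n n ℂ}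
    (hρ : IsDensity ρ) (e : m ≃ n) : IsDensity (ρ.submatrix e e) :=
  ⟨hρ.1.submatrix e, (e.sum_comp fun i => ρ i i).trans hρ.2⟩

/-- for every `d ≥ 2` there exists a universal quantum masker for
`d`-dimensional states whose safe state has von Neumann entropy exactly `log₂ d`. -/
theorem exists_masker_with_minimal_entropy (d : ℕ) (hd : 2 ≤ d) :
    ∃ (s dA dB : ℕ) (_ : 0 < s) (_ : 0 < dA) (_ : 0 < dB) (_ : d * s = dA * dB)
      (M : Matrix (Fin dA × Fin dB) (Fin d × Fin s) ℂ)
      (ω : Matrix (Fin s) (Fin s) ℂ),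
      IsMasker d s dA dB M ω ∧ vNEntropy ω = Real.logb 2 d := by
  have : NeZero d := ⟨by lia⟩
  let eI : Fin d ≃ ZMod d := Fintype.equivOfCardEq (by simp [ZMod.card])
  let eS : Fin (d * (d * d)) ≃ ZMod d × (ZMod d × ZMod d) :=
    Fintype.equivOfCardEq (by simp [ZMod.card])
  let eA : Fin (d * d) ≃ ZMod d × ZMod d := Fintype.equivOfCardEq (by simp [ZMod.card])
  let M := (hexagonEncoding d).submatrix (Equiv.prodCongr eA eA) (Equiv.prodCongr eI eS)
  let σ : Matrix (Fin (d * d)) (Fin (d * d)) ℂ := ((((d : ℝ) ^ 2)⁻¹ : ℝ) : ℂ) • 1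
  have hω : IsDensity (diagonal (safeWeight d ∘ eS)) := by
    rw [← Matrix.submatrix_diagonal_equiv]
    exact isDensity_diagonal_safeWeight.submatrix_equiv eS
  have hσ : IsDensity σ :=
    isDensity_inv_smul_one (by positivity) (by simp [sq])
  have hM : Mᴴ * M = 1 := by
    simp only [M, Matrix.conjTranspose_submatrix, Matrix.submatrix_mul_equiv,
      hexagonEncoding_conjTranspose_mul_self, Matrix.submatrix_one_equiv]
  have hdim : d * (d * (d * d)) = d * d * (d * d) := by ring
  have hpos : 0 < d := by lia
  refine ⟨d * (d * d), d * d, d * d, by positivity, by positivity, by positivity, hdim, M,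
    diagonal (safeWeight d ∘ eS), ⟨hM, ?_, hω, σ, σ, hσ, hσ, fun ρ hρ => ⟨?_, ?_⟩⟩, ?_⟩
  · exact (Matrix.mul_eq_one_comm_of_equiv
      (Fintype.equivOfCardEq (by simpa using hdim))).1 hM
  · refine ptrace2_eq_of_masking (fun i i' a a' => ?_) hρ
    have h := hexagonEncoding_marginal_fst (eI i) (eI i') (eA a) (eA a')
    rw [← eS.sum_comp] at h
    simp only [← eA.sum_comp, eI.injective.eq_iff, eA.injective.eq_iff] at h
    simpa [M, σ, Matrix.one_apply] using h
  · refine ptrace1_eq_of_masking (fun i i' b b' => ?_) hρ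
    have h := hexagonEncoding_marginal_snd (eI i) (eI i') (eA b) (eA b')
    rw [← eS.sum_comp] at h
    simp only [← eA.sum_comp, eI.injective.eq_iff, eA.injective.eq_iff] at h
    simpa [M, σ, Matrix.one_apply] using h
  · refine vNEntropy_eq_logb_of_mul_self hω ?_
    rw [Matrix.diagonal_mul_diagonal, ← Matrix.diagonal_smul]
    exact congrArg diagonal (funext fun t => safeWeight_mul_self (eS t))

end
end

section
/- Output of the generalized 4-qudit masker has maximally mixed marginals: let d ≥ 2 and α ∈ ℂ^d with ∑_{j=0}^{d-1}|α_j|² = 1. In ℂ^d⊗ℂ^d define the vectors |Ψ_n⟩ = ∑_{j=0}^{d-1} α_{(n+j) mod d} |j⟩⊗|j⟩ and |Φ_n⟩ = d^{-1/2} ∑_{j=0}^{d-1} e^{2πi jn/d} |j⟩⊗|j⟩ for n = 0, …, d-1, and let ρ_out = (1/d) ∑_{n=0}^{d-1} |Ψ_n⟩⟨Ψ_n| ⊗ |Φ_n⟩⟨Φ_n|, a density matrix on (ℂ^d⊗ℂ^d)⊗(ℂ^d⊗ℂ^d) whose four tensor factors are labeled A₁, B₁, A₂, B₂ in order. Then the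 partial trace of ρ_out over (B₁, B₂) equals (1/d²)·I on ℂ^d⊗ℂ^d, and the partial trace of ρ_out over (A₁, A₂) also equals (1/d²)·I. -/
open Matrix Kronecker
open scoped ComplexOrder

noncomputable section

/-- Partial trace over the two `B` factors of a state on `A₁ ⊗ B₁ ⊗ A₂ ⊗ B₂`
(factors grouped as `(A₁ × B₁) × (A₂ × B₂)`). -/
def ptraceBB {a₁ b₁ a₂ b₂ : Type*} [Fintype b₁] [Fintype b₂]
    (ρ : Matrix ((a₁ × b₁) × (a₂ × b₂)) ((a₁ × b₁) × (a₂ × b₂)) ℂ) :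
    Matrix (a₁ × a₂) (a₁ × a₂) ℂ :=
  Matrix.of fun a a' => ∑ j₁, ∑ j₂, ρ ((a.1, j₁), (a.2, j₂)) ((a'.1, j₁), (a'.2, j₂))

/-- Partial trace over the two `A` factors of a state on `A₁ ⊗ B₁ ⊗ A₂ ⊗ B₂`
(factors grouped as `(A₁ × B₁) × (A₂ × B₂)`). -/
def ptraceAA {a₁ b₁ a₂ b₂ : Type*} [Fintype a₁] [Fintype a₂]
    (ρ : Matrix ((a₁ × b₁) × (a₂ × b₂)) ((a₁ × b₁) × (a₂ × b₂)) ℂ) :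
    Matrix (b₁ × b₂) (b₁ × b₂) ℂ :=
  Matrix.of fun b b' => ∑ i₁, ∑ i₂, ρ ((i₁, b.1), (i₂, b.2)) ((i₁, b'.1), (i₂, b'.2))

theorem ptraceBB_smul_sum_kronecker {ι a₁ b₁ a₂ b₂ : Type*} [Fintype b₁] [Fintype b₂]
    (c : ℂ) (s : Finset ι) (A : ι → Matrix (a₁ × b₁) (a₁ × b₁) ℂ)
    (B : ι → Matrix (a₂ × b₂) (a₂ × b₂) ℂ) :
    ptraceBB (c • ∑ n ∈ s, A n ⊗ₖ B n) = c • ∑ n ∈ s, ptrace2 (A n) ⊗ₖ ptrace2 (B n) := by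
  ext i j
  simp only [ptraceBB, ptrace2, Matrix.of_apply, Matrix.smul_apply, Matrix.sum_apply,
    Matrix.kroneckerMap_apply, smul_eq_mul, ← Finset.mul_sum, Finset.sum_mul_sum]
  congr 1
  simp only [← Finset.mul_sum, Finset.sum_comm (t := s)]

theorem ptraceAA_smul_sum_kronecker {ι a₁ b₁ a₂ b₂ : Type*} [Fintype a₁] [Fintype a₂]
    (c : ℂ) (s : Finset ι) (A : ι → Matrix (a₁ × b₁) (a₁ × b₁) ℂ)
    (B : ι → Matrix (a₂ × b₂) (a₂ × b₂) ℂ) :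
    ptraceAA (c • ∑ n ∈ s, A n ⊗ₖ B n) = c • ∑ n ∈ s, ptrace1 (A n) ⊗ₖ ptrace1 (B n) := by
  ext i j
  simp only [ptraceAA, ptrace1, Matrix.of_apply, Matrix.smul_apply, Matrix.sum_apply,
    Matrix.kroneckerMap_apply, smul_eq_mul, ← Finset.mul_sum, Finset.sum_mul_sum]
  congr 1
  simp only [← Finset.mul_sum, Finset.sum_comm (t := s)]

/-- The first marginal of `∑ j, f j |j⟩ ⊗ |j⟩` is diagonal with entries `|f j|²`. -/
theorem ptrace2_outer_of_diagonal {m : Type*} [Fintype m] [DecidableEq m] (f : m → ℂ)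
    {ψ : m × m → ℂ} (hψ : ∀ q, ψ q = if q.1 = q.2 then f q.1 else 0) :
    ptrace2 (outer ψ) = Matrix.diagonal fun j => ((‖f j‖ ^ 2 : ℝ) : ℂ) := by
  ext i j
  by_cases h : i = j
  · subst h
    simp [ptrace2, outer, hψ, Complex.mul_conj, Complex.normSq_eq_norm_sq]
  · simp [ptrace2, outer, hψ, h, Ne.symm h]

/-- The second marginal of `∑ j, f j |j⟩ ⊗ |j⟩` is diagonal with entries `|f j|²`. -/
theorem ptrace1_outer_of_diagonal {m : Type*} [Fintype m] [DecidableEq m] (f : m → ℂ)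
    {ψ : m × m → ℂ} (hψ : ∀ q, ψ q = if q.1 = q.2 then f q.1 else 0) :
    ptrace1 (outer ψ) = Matrix.diagonal fun j => ((‖f j‖ ^ 2 : ℝ) : ℂ) := by
  ext i j
  by_cases h : i = j
  · subst h
    simp [ptrace1, outer, hψ, Complex.mul_conj, Complex.normSq_eq_norm_sq]
  · simp [ptrace1, outer, hψ, h]

theorem norm_sq_inv_sqrt_mul_exp (d j n : ℕ) :
    ‖((Real.sqrt d : ℂ))⁻¹ * Complex.exp (2 * Real.pi * Complex.I * j * n / d)‖ ^ 2 =
      (d : ℝ)⁻¹ := by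
  have h : (2 * Real.pi * Complex.I * j * n / d : ℂ) =
      ((2 * Real.pi * j * n / d : ℝ) : ℂ) * Complex.I := by
    push_cast
    ring
  rw [h, norm_mul, Complex.norm_exp_ofReal_mul_I, mul_one, norm_inv, Complex.norm_real, inv_pow,
    Real.norm_eq_abs, sq_abs, Real.sq_sqrt d.cast_nonneg]

theorem smul_sum_diagonal_shift_kronecker {d : ℕ} (p : Fin d → ℝ) (hp : ∑ j, p j = 1) :
    (d : ℂ)⁻¹ • ∑ n : Fin d, Matrix.diagonal (fun j : Fin d => (p (n + j) : ℂ)) ⊗ₖ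
      Matrix.diagonal (fun _ : Fin d => (((d : ℝ)⁻¹ : ℝ) : ℂ)) = ((d : ℂ) ^ 2)⁻¹ • 1 := by
  ext i j
  by_cases h : i = j
  · subst h
    have : NeZero d := ⟨fun h => (h ▸ i.1).elim0⟩
    have key : ∑ n, (p (n + i.1) : ℂ) = 1 := by
      refine (Equiv.sum_comp (Equiv.addRight i.1) fun k => (p k : ℂ)).trans ?_
      exact_mod_cast hp
    simp [Matrix.sum_apply, Matrix.kroneckerMap_apply, ← Finset.sum_mul, key, sq]
  · simp only [Matrix.diagonal_kronecker_diagonal, Matrix.smul_apply, Matrix.sum_apply,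
      Matrix.diagonal_apply_ne _ h, Matrix.one_apply_ne h, Finset.sum_const_zero, smul_zero]

/-- the output of the generalized 4-qudit masker has maximally mixed
marginals on `A₁A₂` and on `B₁B₂`. -/
theorem four_qudit_masker_marginals (d : ℕ) (hd : 2 ≤ d)
    (α : Fin d → ℂ) (hα : ∑ j, ‖α j‖ ^ 2 = 1)
    (Ψ Φ : Fin d → (Fin d × Fin d → ℂ))
    (hΨ : ∀ n q, Ψ n q = if q.1 = q.2 then α (n + q.1) else 0)
    (hΦ : ∀ n q, Φ n q = if q.1 = q.2 then
      ((Real.sqrt d : ℂ))⁻¹ * Complex.exp (2 * Real.pi * Complex.I * (q.1 : ℕ) * (n : ℕ) / d)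
      else 0)
    (ρout : Matrix ((Fin d × Fin d) × (Fin d × Fin d)) ((Fin d × Fin d) × (Fin d × Fin d)) ℂ)
    (hρout : ρout = (d : ℂ)⁻¹ • ∑ n : Fin d, outer (Ψ n) ⊗ₖ outer (Φ n)) :
    ptraceBB ρout = ((d : ℂ) ^ 2)⁻¹ • 1 ∧ ptraceAA ρout = ((d : ℂ) ^ 2)⁻¹ • 1 := by
  let φ (n j : Fin d) : ℂ :=
    ((Real.sqrt d : ℂ))⁻¹ * Complex.exp (2 * Real.pi * Complex.I * (j : ℕ) * (n : ℕ) / d)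
  have hφ (n j : Fin d) : ‖φ n j‖ ^ 2 = (d : ℝ)⁻¹ := norm_sq_inv_sqrt_mul_exp d j n
  have key := smul_sum_diagonal_shift_kronecker (fun j => ‖α j‖ ^ 2) hα
  rw [hρout, ptraceBB_smul_sum_kronecker, ptraceAA_smul_sum_kronecker]
  simp only [fun n => ptrace2_outer_of_diagonal (fun j => α (n + j)) (hΨ n),
    fun n => ptrace1_outer_of_diagonal (fun j => α (n + j)) (hΨ n),
    fun n => ptrace2_outer_of_diagonal (φ n) (hΦ n),
    fun n => ptrace1_outer_of_diagonal (φ n) (hΦ n), hφ]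
  exact ⟨key, key⟩

end
end

section
/- Let (M, ω) be a universal quantum masker for d-dimensional states, with M a unitary from ℂ^d⊗ℂ^s to ℂ^{d_A}⊗ℂ^{d_B}, and suppose there are finitely many weights q_i > 0 with ∑_i q_i = 1, an orthonormal family {e_i} in ℂ^{d_B}, and linear maps N_i from d×d complex matrices to d_A×d_A complex matrices mapping density matrices to density matrices, such that for every density matrix ρ on ℂ^d, M(ρ⊗ω)M† = ∑_i q_i N_i(ρ) ⊗ |e_i⟩⟨e_i|. Then for all density matrices ρ, σ on ℂ^d with ρσ = 0, one has Tr[N_i(ρ) N_i(σ)] = 0 for every i. -/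
open Matrix Kronecker
open scoped ComplexOrder

noncomputable section

theorem outer_eq_vecMulVec {n : Type*} (v : n → ℂ) : outer v = vecMulVec v (star v) := rfl

theorem trace_outer {n : Type*} [Fintype n] (v : n → ℂ) : (outer v).trace = star v ⬝ᵥ v := by
  rw [outer_eq_vecMulVec, trace_vecMulVec, dotProduct_comm]

/-- The projections onto an orthonormal family are idempotent and mutually orthogonal. -/
theorem outer_mul_outer {ι n : Type*} [Fintype n] [DecidableEq ι] {e : ι → n → ℂ}
    (he : ∀ i j, star (e i) ⬝ᵥ e j = if i = j then 1 else 0) (i j : ι) :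
    outer (e i) * outer (e j) = if i = j then outer (e j) else 0 := by
  simp only [outer_eq_vecMulVec, vecMulVec_mul_vecMulVec, he]
  split_ifs with h <;> simp [h]

/-- Multiplying a quantum-classical operator by `X ⊗ |e_i⟩⟨e_i|` selects its `i`-th component. -/
theorem sum_kronecker_outer_mul {ι m n : Type*} [Fintype ι] [DecidableEq ι] [Fintype m]
    [Fintype n] {e : ι → n → ℂ}
    (he : ∀ i j, star (e i) ⬝ᵥ e j = if i = j then 1 else 0)
    (c : ι → ℂ) (A : ι → Matrix m m ℂ) (X : Matrix m m ℂ) (i : ι) :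
    (∑ j, c j • (A j ⊗ₖ outer (e j))) * (X ⊗ₖ outer (e i)) =
      c i • ((A i * X) ⊗ₖ outer (e i)) := by
  rw [Finset.sum_mul, Finset.sum_eq_single i]
  · rw [smul_mul_assoc, ← mul_kronecker_mul, outer_mul_outer he, if_pos rfl]
  · intro j _ hj
    rw [smul_mul_assoc, ← mul_kronecker_mul, outer_mul_outer he, if_neg hj, kronecker_zero,
      smul_zero]
  · simp

/-- if a universal quantum masker has quantum-classical outputs
`M (ρ ⊗ ω) M† = ∑ i q_i N_i(ρ) ⊗ |e_i⟩⟨e_i|`, then the maps `N_i` send density matrices with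
orthogonal supports to trace-orthogonal states. -/
theorem qc_masker_component_orthogonality
    (d s dA dB : ℕ)
    (M : Matrix (Fin dA × Fin dB) (Fin d × Fin s) ℂ)
    (ω : Matrix (Fin s) (Fin s) ℂ)
    (hM : IsMasker d s dA dB M ω)
    (r : ℕ) (q : Fin r → ℝ) (hq : ∀ i, 0 < q i) (hq1 : ∑ i, q i = 1)
    (e : Fin r → (Fin dB → ℂ))
    (he : ∀ i j, star (e i) ⬝ᵥ e j = if i = j then 1 else 0)
    (N : Fin r → (Matrix (Fin d) (Fin d) ℂ →ₗ[ℂ] Matrix (Fin dA) (Fin dA) ℂ))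
    (hN : ∀ i ρ, IsDensity ρ → IsDensity (N i ρ))
    (hdecomp : ∀ ρ : Matrix (Fin d) (Fin d) ℂ, IsDensity ρ →
      M * (ρ ⊗ₖ ω) * Mᴴ = ∑ i, (q i : ℂ) • (N i ρ ⊗ₖ outer (e i)))
    (ρ σ : Matrix (Fin d) (Fin d) ℂ) (hρ : IsDensity ρ) (hσ : IsDensity σ)
    (hortho : ρ * σ = 0) (i : Fin r) :
    (N i ρ * N i σ).trace = 0 := by
  obtain ⟨hMM, -, -, -⟩ := hM
  have hprod : (M * (ρ ⊗ₖ ω) * Mᴴ) * (M * (σ ⊗ₖ ω) * Mᴴ) = 0 := by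
    calc (M * (ρ ⊗ₖ ω) * Mᴴ) * (M * (σ ⊗ₖ ω) * Mᴴ)
        = M * ((ρ ⊗ₖ ω) * (Mᴴ * M) * (σ ⊗ₖ ω)) * Mᴴ := by simp only [Matrix.mul_assoc]
      _ = 0 := by
        rw [hMM, Matrix.mul_one, ← mul_kronecker_mul, hortho, zero_kronecker, Matrix.mul_zero,
          Matrix.zero_mul]
  have hcomp : (q i : ℂ) • (q i : ℂ) • ((N i ρ * N i σ) ⊗ₖ outer (e i)) = 0 := by
    have h := congrArg (· * ((1 : Matrix (Fin dA) (Fin dA) ℂ) ⊗ₖ outer (e i))) hprod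
    simpa only [hdecomp ρ hρ, hdecomp σ hσ, Matrix.mul_assoc, sum_kronecker_outer_mul he,
      Matrix.mul_smul, Matrix.mul_one, Matrix.zero_mul] using h
  have hqi : (q i : ℂ) ≠ 0 := Complex.ofReal_ne_zero.mpr (hq i).ne'
  have hzero := (smul_eq_zero_iff_right hqi).mp ((smul_eq_zero_iff_right hqi).mp hcomp)
  simpa [trace_kronecker, trace_outer, he] using congrArg Matrix.trace hzero

end
end

section
/- A quantum channel that maps states with orthogonal support to trace-orthogonal states preserves the trace norm of Hermitian matrices: let N be a quantum channel (CPTP map) from d×d complex matrices to m×m complex matrices such that for all density matrices ρ, σ on ℂ^d with ρσ = 0 one has Tr[N(ρ)N(σ)] = 0. Then for every Hermitian d×d matrix H, ‖N(H)‖₁ = ‖H‖₁. -/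
open Matrix Kronecker
open scoped ComplexOrder

noncomputable section

/-- A linear map between matrix algebras is a quantum channel (CPTP map) if it admits a
Kraus representation `A ↦ ∑ k, K k * A * (K k)ᴴ` with `∑ k, (K k)ᴴ * K k = 1`. -/
def IsCPTP {m n : Type*} [Fintype m] [Fintype n] [DecidableEq m]
    (E : Matrix m m ℂ →ₗ[ℂ] Matrix n n ℂ) : Prop :=
  ∃ (r : ℕ) (K : Fin r → Matrix n m ℂ),
    (∀ A, E A = ∑ k, K k * A * (K k)ᴴ) ∧ (∑ k, (K k)ᴴ * K k = 1)

/-- The trace norm of a Hermitian matrix: the sum of the absolute values of its eigenvalues. -/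
def traceNorm {n : Type*} [Fintype n] [DecidableEq n] (H : Matrix n n ℂ) : ℝ :=
  if h : H.IsHermitian then ∑ i, |h.eigenvalues i| else 0

open scoped MatrixOrder in
/-- The trace norm of a Hermitian matrix is the trace of its absolute value. -/
lemma traceNorm_eq_trace_abs {n : Type*} [Fintype n] [DecidableEq n] {A : Matrix n n ℂ}
    (hA : A.IsHermitian) : (traceNorm A : ℂ) = (CFC.abs A).trace := by
  rw [CFC.abs_eq_cfc_norm A, hA.cfc_eq, Matrix.IsHermitian.cfc, Unitary.conjStarAlgAut_apply,
    Matrix.trace_mul_cycle, Unitary.coe_star_mul_self, one_mul, Matrix.trace_diagonal]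
  simp [traceNorm, hA]

open scoped MatrixOrder in
/-- The trace norm of a difference of orthogonal positive semidefinite matrices. -/
lemma traceNorm_sub_of_mul_eq_zero {n : Type*} [Fintype n] [DecidableEq n]
    {A B : Matrix n n ℂ} (hA : A.PosSemidef) (hB : B.PosSemidef) (hAB : A * B = 0) :
    (traceNorm (A - B) : ℂ) = A.trace + B.trace := by
  have hBA : B * A = 0 := by
    have h := congrArg conjTranspose hAB
    rwa [conjTranspose_mul, hA.1.eq, hB.1.eq, conjTranspose_zero] at h
  have hsub := hA.1.sub hB.1
  rw [traceNorm_eq_trace_abs hsub, ← Matrix.trace_add]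
  congr 1
  rw [CFC.abs]
  refine CFC.sqrt_unique ?_ (hA.add hB).nonneg
  rw [star_eq_conjTranspose, hsub.eq]
  simp [add_mul, mul_add, sub_mul, mul_sub, hAB, hBA]

open scoped MatrixOrder in
/-- Positive semidefinite matrices that are trace-orthogonal have zero product. -/
lemma Matrix.PosSemidef.mul_eq_zero_of_trace_mul_eq_zero {n : Type*} [Fintype n]
    {A B : Matrix n n ℂ} (hA : A.PosSemidef) (hB : B.PosSemidef) (h : (A * B).trace = 0) :
    A * B = 0 := by
  classical
  obtain ⟨X, rfl⟩ := CStarAlgebra.nonneg_iff_eq_star_mul_self.mp hA.nonneg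
  obtain ⟨Y, rfl⟩ := CStarAlgebra.nonneg_iff_eq_star_mul_self.mp hB.nonneg
  simp only [star_eq_conjTranspose] at h ⊢
  have hXY : X * Yᴴ = 0 := by
    rw [← trace_mul_conjTranspose_self_eq_zero_iff, conjTranspose_mul, conjTranspose_conjTranspose,
      ← h, ← mul_assoc, Matrix.trace_mul_comm]
    simp only [mul_assoc]
  rw [mul_assoc, ← mul_assoc X, hXY, zero_mul, mul_zero]

lemma IsCPTP.posSemidef {m n : Type*} [Fintype m] [Fintype n] [DecidableEq m]
    {E : Matrix m m ℂ →ₗ[ℂ] Matrix n n ℂ} (hE : IsCPTP E) {A : Matrix m m ℂ}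
    (hA : A.PosSemidef) : (E A).PosSemidef := by
  obtain ⟨r, K, hK, -⟩ := hE
  rw [hK]
  exact posSemidef_sum _ fun k _ => hA.mul_mul_conjTranspose_same (K k)

lemma IsCPTP.trace_apply {m n : Type*} [Fintype m] [Fintype n] [DecidableEq m]
    {E : Matrix m m ℂ →ₗ[ℂ] Matrix n n ℂ} (hE : IsCPTP E) (A : Matrix m m ℂ) :
    (E A).trace = A.trace := by
  obtain ⟨r, K, hK, hK1⟩ := hE
  rw [hK, Matrix.trace_sum,
    Finset.sum_congr rfl fun k _ => Matrix.trace_mul_cycle (K k) A (K k)ᴴ,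
    ← Matrix.trace_sum, ← Matrix.sum_mul, hK1, one_mul]

/-- A nonzero positive semidefinite matrix is normalized to a density matrix. -/
lemma Matrix.PosSemidef.isDensity_inv_trace_smul {n : Type*} [Fintype n] {A : Matrix n n ℂ}
    (hA : A.PosSemidef) (h0 : A ≠ 0) : IsDensity (A.trace⁻¹ • A) := by
  have ht : A.trace ≠ 0 := fun h => h0 (hA.trace_eq_zero_iff.mp h)
  refine ⟨hA.smul (inv_nonneg.mpr hA.trace_nonneg), ?_⟩
  rw [Matrix.trace_smul, smul_eq_mul, inv_mul_cancel₀ ht]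

/-- a quantum channel sending density matrices with orthogonal supports to
trace-orthogonal states preserves the trace norm of Hermitian matrices. -/
theorem channel_orthogonality_preserves_trace_norm
    (d m : ℕ)
    (N : Matrix (Fin d) (Fin d) ℂ →ₗ[ℂ] Matrix (Fin m) (Fin m) ℂ)
    (hN : IsCPTP N)
    (horth : ∀ ρ σ : Matrix (Fin d) (Fin d) ℂ, IsDensity ρ → IsDensity σ → ρ * σ = 0 →
      (N ρ * N σ).trace = 0)
    (H : Matrix (Fin d) (Fin d) ℂ) (hH : H.IsHermitian) :
    traceNorm (N H) = traceNorm H := by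
  have horth' : ∀ P Q : Matrix (Fin d) (Fin d) ℂ, P.PosSemidef → Q.PosSemidef → P * Q = 0 →
      N P * N Q = 0 := by
    intro P Q hP hQ hPQ
    rcases eq_or_ne P 0 with rfl | hP0
    · simp
    rcases eq_or_ne Q 0 with rfl | hQ0
    · simp
    have ht := horth _ _ (hP.isDensity_inv_trace_smul hP0) (hQ.isDensity_inv_trace_smul hQ0)
      (by simp [hPQ])
    refine (hN.posSemidef hP).mul_eq_zero_of_trace_mul_eq_zero (hN.posSemidef hQ) ?_
    simpa [hP.trace_eq_zero_iff, hQ.trace_eq_zero_iff, hP0, hQ0] using ht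
  open scoped MatrixOrder in
  obtain ⟨P, Q, hP, hQ, hPQ, rfl⟩ : ∃ P Q : Matrix (Fin d) (Fin d) ℂ,
      P.PosSemidef ∧ Q.PosSemidef ∧ P * Q = 0 ∧ P - Q = H :=
    ⟨H⁺, H⁻, (CFC.posPart_nonneg H).posSemidef, (CFC.negPart_nonneg H).posSemidef,
      CFC.posPart_mul_negPart H, CFC.posPart_sub_negPart H hH⟩
  have key : (traceNorm (N (P - Q)) : ℂ) = traceNorm (P - Q) := by
    rw [map_sub, traceNorm_sub_of_mul_eq_zero (hN.posSemidef hP) (hN.posSemidef hQ)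
      (horth' P Q hP hQ hPQ), traceNorm_sub_of_mul_eq_zero hP hQ hPQ, hN.trace_apply,
      hN.trace_apply]
  exact_mod_cast key

end
end

section
/- Bound on the cheating probability in the initializer scheme: let p be a prime, let J be a nonempty subset of {1, …, p-1}, let {|Ω_{a,b}⟩ : (a,b) ∈ ℤ_p × ℤ_p} be an orthonormal family of p² vectors in ℂ^{p²}, and let Λ be a density matrix on ℂ^{p²}. If (Δ₁, Δ₂) ∈ ℤ_p × ℤ_p with (Δ₁, Δ₂) ≠ (0, 0), then (1/|J|²) ∑_{j₁∈J} ∑_{j₂∈J} ⟨Ω_{j₁Δ₁ mod p, j₂Δ₂ mod p} | Λ | Ω_{j₁Δ₁ mod p, j₂Δ₂ mod p}⟩ ≤ 1/|J|. -/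
open Matrix Kronecker
open scoped ComplexOrder

noncomputable section

/-- The expectation values of a density matrix along a full orthonormal family sum to 1. -/
lemma IsDensity.sum_expectation_eq_one {ι n : Type*} [Fintype ι] [DecidableEq ι] [Fintype n]
    (hcard : Fintype.card ι = Fintype.card n) {Ω : ι → n → ℂ}
    (hΩ : ∀ v w, star (Ω v) ⬝ᵥ Ω w = if v = w then 1 else 0)
    {ρ : Matrix n n ℂ} (hρ : IsDensity ρ) :
    ∑ v, (star (Ω v) ⬝ᵥ (ρ *ᵥ Ω v)).re = 1 := by
  classical
  let U : Matrix n ι ℂ := Matrix.of fun i v => Ω v i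
  have hU : Uᴴ * U = 1 := by
    ext v w
    rw [Matrix.one_apply, ← hΩ v w]
    rfl
  have hU' : U * Uᴴ = 1 := (Matrix.mul_eq_one_comm_of_card_eq _ _ _ hcard).mp hU
  have htr : (Uᴴ * (ρ * U)).trace = 1 := by
    rw [Matrix.trace_mul_comm, Matrix.mul_assoc, hU', Matrix.mul_one, hρ.2]
  rw [← Complex.re_sum, ← Complex.one_re, ← htr]
  rfl

/-- The expectation values of a density matrix along part of a full orthonormal family sum to at
most 1. -/
lemma IsDensity.sum_expectation_comp_le_one {κ ι n : Type*} [Fintype ι] [DecidableEq ι]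
    [Fintype n] (hcard : Fintype.card ι = Fintype.card n) {Ω : ι → n → ℂ}
    (hΩ : ∀ v w, star (Ω v) ⬝ᵥ Ω w = if v = w then 1 else 0)
    {ρ : Matrix n n ℂ} (hρ : IsDensity ρ) (s : Finset κ) {f : κ → ι}
    (hf : Function.Injective f) :
    ∑ k ∈ s, (star (Ω (f k)) ⬝ᵥ (ρ *ᵥ Ω (f k))).re ≤ 1 := by
  rw [← hρ.sum_expectation_eq_one hcard hΩ]
  refine (Finset.sum_map s ⟨f, hf⟩ fun v => (star (Ω v) ⬝ᵥ (ρ *ᵥ Ω v)).re).symm.trans_le ?_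
  exact Finset.sum_le_sum_of_subset_of_nonneg (Finset.subset_univ _) fun v _ _ =>
    (Complex.nonneg_iff.mp (hρ.1.dotProduct_mulVec_nonneg (Ω v))).1

/-- bound on the cheating probability in the initializer scheme. -/
theorem cheating_probability_bound
    (p : ℕ) (hp : p.Prime)
    (J : Finset (ZMod p)) (hJ0 : (0 : ZMod p) ∉ J) (hJne : J.Nonempty)
    (Ω : ZMod p × ZMod p → (Fin (p ^ 2) → ℂ))
    (hΩ : ∀ v w, star (Ω v) ⬝ᵥ Ω w = if v = w then 1 else 0)
    (Λ : Matrix (Fin (p ^ 2)) (Fin (p ^ 2)) ℂ) (hΛ : IsDensity Λ)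
    (Δ₁ Δ₂ : ZMod p) (hΔ : (Δ₁, Δ₂) ≠ (0, 0)) :
    ((J.card : ℝ) ^ 2)⁻¹ * ∑ j₁ ∈ J, ∑ j₂ ∈ J,
        (star (Ω (j₁ * Δ₁, j₂ * Δ₂)) ⬝ᵥ (Λ *ᵥ Ω (j₁ * Δ₁, j₂ * Δ₂))).re
      ≤ (J.card : ℝ)⁻¹ := by
  have : Fact p.Prime := ⟨hp⟩
  have hcard : Fintype.card (ZMod p × ZMod p) = Fintype.card (Fin (p ^ 2)) := by
    simp [ZMod.card, sq]
  have hJ : (0 : ℝ) < J.card := by exact_mod_cast hJne.card_pos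
  have hsum : ∑ j₁ ∈ J, ∑ j₂ ∈ J,
      (star (Ω (j₁ * Δ₁, j₂ * Δ₂)) ⬝ᵥ (Λ *ᵥ Ω (j₁ * Δ₁, j₂ * Δ₂))).re ≤ J.card := by
    by_cases h₂ : Δ₂ = 0
    · have h₁ : Δ₁ ≠ 0 := fun h₁ => hΔ (by rw [h₁, h₂])
      rw [Finset.sum_comm]
      refine (Finset.sum_le_card_nsmul J _ 1 fun j₂ _ => ?_).trans_eq (by simp)
      exact hΛ.sum_expectation_comp_le_one hcard hΩ J (f := fun j₁ => (j₁ * Δ₁, j₂ * Δ₂))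
        fun a b hab => mul_right_cancel₀ h₁ (Prod.ext_iff.mp hab).1
    · refine (Finset.sum_le_card_nsmul J _ 1 fun j₁ _ => ?_).trans_eq (by simp)
      exact hΛ.sum_expectation_comp_le_one hcard hΩ J (f := fun j₂ => (j₁ * Δ₁, j₂ * Δ₂))
        fun a b hab => mul_right_cancel₀ h₂ (Prod.ext_iff.mp hab).2
  calc _ ≤ ((J.card : ℝ) ^ 2)⁻¹ * J.card := by gcongr
    _ = (J.card : ℝ)⁻¹ := by field_simp

end
end

section
/- No-masking theorem (zero-randomness case): let d ≥ 2. There do not exist positive integers s, d_A, d_B with d·s = d_A·d_B, a unitary M from ℂ^d⊗ℂ^s to ℂ^{d_A}⊗ℂ^{d_B}, and a unit vector |ω⟩ ∈ ℂ^s such that (M, |ω⟩⟨ω|) is a universal quantum masker for d-dimensional states; that is, no universal quantum masker has a pure safe state. -/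
open Matrix Kronecker
open scoped ComplexOrder

noncomputable section

theorem isDensity_outer {n : Type*} [Fintype n] {v : n → ℂ} (hv : v ⬝ᵥ star v = 1) :
    IsDensity (outer v) :=
  ⟨Matrix.posSemidef_vecMulVec_self_star v, hv⟩

theorem kronecker_outer {m n : Type*} (v : m → ℂ) (w : n → ℂ) :
    outer v ⊗ₖ outer w = outer fun p : m × n => v p.1 * w p.2 := by
  ext p q
  simp [outer, mul_mul_mul_comm]

theorem mul_outer_mul_conjTranspose {m n : Type*} [Fintype n] (M : Matrix m n ℂ) (v : n → ℂ) :
    M * outer v * Mᴴ = outer (M *ᵥ v) := by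
  change M * vecMulVec v (star v) * Mᴴ = vecMulVec (M *ᵥ v) (star (M *ᵥ v))
  rw [Matrix.mul_vecMulVec, Matrix.vecMulVec_mul, Matrix.star_mulVec]

/-- The coefficient matrix of a bipartite vector. -/
def coeffMatrix {m n : Type*} (v : m × n → ℂ) : Matrix m n ℂ :=
  Matrix.of fun i j => v (i, j)

theorem ptrace2_outer {m n : Type*} [Fintype n] (v : m × n → ℂ) :
    ptrace2 (outer v) = coeffMatrix v * (coeffMatrix v)ᴴ := by
  ext i j
  simp [ptrace2, outer, coeffMatrix, Matrix.mul_apply]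

theorem ptrace1_outer {m n : Type*} [Fintype m] (v : m × n → ℂ) :
    ptrace1 (outer v) = ((coeffMatrix v)ᴴ * coeffMatrix v)ᵀ := by
  ext i j
  simp [ptrace1, outer, coeffMatrix, Matrix.mul_apply, mul_comm]

/-- The coefficient matrix of `M (ψ ⊗ ω)`. -/
def imageMatrix {a b m n : Type*} [Fintype m] [Fintype n] (M : Matrix (a × b) (m × n) ℂ)
    (ω : n → ℂ) (ψ : m → ℂ) : Matrix a b ℂ :=
  coeffMatrix (M *ᵥ fun p => ψ p.1 * ω p.2)

theorem imageMatrix_linear_combination {a b m n : Type*} [Fintype m] [Fintype n]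
    (M : Matrix (a × b) (m × n) ℂ) (ω : n → ℂ) (x y : ℂ) (ψ φ : m → ℂ) :
    imageMatrix M ω (x • ψ + y • φ) = x • imageMatrix M ω ψ + y • imageMatrix M ω φ := by
  ext i j
  simp only [imageMatrix, coeffMatrix, Matrix.mulVec, dotProduct, Matrix.of_apply,
    Matrix.add_apply, Matrix.smul_apply, Pi.add_apply, Pi.smul_apply, smul_eq_mul,
    Finset.mul_sum, ← Finset.sum_add_distrib]
  exact Finset.sum_congr rfl fun p _ => by ring

/-- If `Z * Zᴴ` is the same for all normalized superpositions `Z` of `X` and `Y`, then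
`X * Yᴴ = 0`. -/
theorem mul_conjTranspose_eq_zero_of_superpositions {m n : Type*} [Fintype n]
    {X Y : Matrix m n ℂ} {σ : Matrix m m ℂ}
    (h : ∀ x y : ℂ, x * star x + y * star y = 1 →
      (x • X + y • Y) * (x • X + y • Y)ᴴ = σ) :
    X * Yᴴ = 0 := by
  have hX := h 1 0 (by simp)
  have hY := h 0 1 (by simp)
  have hr := h (3 / 5) (4 / 5) (by simp; norm_num)
  have hi := h (3 / 5) (4 / 5 * Complex.I) (by
    simp
    linear_combination (-16 / 25 : ℂ) * Complex.I_sq)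
  simp only [one_smul, zero_smul, add_zero, zero_add] at hX hY
  ext i j
  have er := congrFun₂ hr i j
  have ei := congrFun₂ hi i j
  have eX := congrFun₂ hX i j
  have eY := congrFun₂ hY i j
  simp only [Matrix.conjTranspose_add, Matrix.conjTranspose_smul, Matrix.add_mul, Matrix.mul_add,
    Matrix.smul_mul, Matrix.mul_smul, Matrix.add_apply, Matrix.smul_apply, smul_eq_mul] at er ei
  simp only [eX, eY, star_mul', star_div₀, star_ofNat, Complex.star_def, Complex.conj_I] at er ei
  rw [Matrix.zero_apply]
  linear_combination (25 / 24 : ℂ) * er + (25 / 24 : ℂ) * Complex.I * ei +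
    ((X * Yᴴ) i j / 2 - (Y * Xᴴ) i j / 2 + 2 / 3 * σ i j * Complex.I) * Complex.I_sq

theorem eq_zero_of_gram_eq_of_mul_conjTranspose_eq_zero {m n : Type*} [Fintype m] [Fintype n]
    {X Y : Matrix m n ℂ} (hG : Xᴴ * X = Yᴴ * Y) (h0 : X * Yᴴ = 0) : X = 0 := by
  refine Matrix.self_mul_conjTranspose_eq_zero.mp (Matrix.conjTranspose_mul_self_eq_zero.mp ?_)
  rw [Matrix.conjTranspose_mul, Matrix.conjTranspose_conjTranspose, Matrix.mul_assoc,
    ← Matrix.mul_assoc Xᴴ, hG, ← Matrix.mul_assoc, ← Matrix.mul_assoc, h0, Matrix.zero_mul,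
    Matrix.zero_mul]

/-- no-masking theorem (zero-randomness case): no universal quantum masker
for `d`-dimensional states (`d ≥ 2`) has a pure safe state. -/
theorem no_masking_with_pure_safe_state (d : ℕ) (hd : 2 ≤ d) :
    ¬ ∃ (s dA dB : ℕ) (_ : 0 < s) (_ : 0 < dA) (_ : 0 < dB) (_ : d * s = dA * dB)
      (M : Matrix (Fin dA × Fin dB) (Fin d × Fin s) ℂ)
      (ω : Fin s → ℂ) (_ : ∑ x, ‖ω x‖ ^ 2 = 1),
      IsMasker d s dA dB M (outer ω) := by
  rintro ⟨s, dA, dB, -, -, -, -, M, ω, -, -, -, -, σA, σB, hσA, -, hM⟩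
  have key (ψ : Fin d → ℂ) (hψ : ψ ⬝ᵥ star ψ = 1) :
      imageMatrix M ω ψ * (imageMatrix M ω ψ)ᴴ = σA ∧
        ((imageMatrix M ω ψ)ᴴ * imageMatrix M ω ψ)ᵀ = σB := by
    simpa only [imageMatrix, kronecker_outer, mul_outer_mul_conjTranspose, ptrace2_outer, ptrace1_outer]
      using hM (outer ψ) (isDensity_outer hψ)
  let e (i : Fin d) : Fin d → ℂ := Pi.single i 1
  let i₀ : Fin d := ⟨0, by omega⟩
  let i₁ : Fin d := ⟨1, by omega⟩
  have hne : i₀ ≠ i₁ := by simp [i₀, i₁]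
  have he (i : Fin d) : e i ⬝ᵥ star (e i) = 1 := by simp [e]
  have h0 : imageMatrix M ω (e i₀) * (imageMatrix M ω (e i₁))ᴴ = 0 := by
    refine mul_conjTranspose_eq_zero_of_superpositions (σ := σA) fun x y hxy => ?_
    rw [← imageMatrix_linear_combination]
    refine (key _ ?_).1
    simpa [e, add_dotProduct, dotProduct_add, hne, hne.symm, mul_comm] using hxy
  have hG := Matrix.transpose_injective ((key _ (he i₀)).2.trans (key _ (he i₁)).2.symm)
  have hX := eq_zero_of_gram_eq_of_mul_conjTranspose_eq_zero hG h0
  have hσ := (key _ (he i₀)).1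
  rw [hX, Matrix.zero_mul] at hσ
  simpa [← hσ] using hσA.2

end
end

section
/- Duality / recoverability from the complement of a hidden share: let M be a unitary from ℂ^d⊗ℂ^s to ℂ^{d_A}⊗ℂ^{d_B}, let |Ω⟩ ∈ ℂ^s⊗ℂ^k be a unit vector, and for a density matrix ρ on ℂ^d define Ψ(ρ) = (M⊗I_k)(ρ⊗|Ω⟩⟨Ω|)(M⊗I_k)†, a density matrix on ℂ^{d_A}⊗ℂ^{d_B}⊗ℂ^k. Suppose the marginal on the first factor is constant: there is a density matrix σ_A on ℂ^{d_A} such that Tr_{BK}[Ψ(ρ)] = σ_A for every density matrix ρ on ℂ^d, where Tr_{BK} traces out the second and third factors. Then there exists a quantum channel R from (d_B·k)×(d_B·k) complex matrices to d×d complex matrices such that R(Tr_A[Ψ(ρ)]) = ρ for every density matrix ρ on ℂ^d, where Tr_A traces out the first factor. -/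
open Matrix Kronecker
open scoped ComplexOrder

noncomputable section

/-- Partial trace over the second and third factors of `A ⊗ B ⊗ K`
(grouped as `(A × B) × K`). -/
def ptraceBK {a b c : Type*} [Fintype b] [Fintype c]
    (T : Matrix ((a × b) × c) ((a × b) × c) ℂ) : Matrix a a ℂ :=
  Matrix.of fun i i' => ∑ j, ∑ x, T ((i, j), x) ((i', j), x)

/-- Partial trace over the first factor of `A ⊗ B ⊗ K` (grouped as `(A × B) × K`). -/
def ptraceA3 {a b c : Type*} [Fintype a]
    (T : Matrix ((a × b) × c) ((a × b) × c) ℂ) : Matrix (b × c) (b × c) ℂ :=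
  Matrix.of fun q q' => ∑ i, T ((i, q.1), q.2) ((i, q'.1), q'.2)

/-- The tripartite state `Ψ(ρ) = (M ⊗ I_k)(ρ ⊗ |Ω⟩⟨Ω|)(M ⊗ I_k)†` on
`ℂ^{dA} ⊗ ℂ^{dB} ⊗ ℂ^k`. -/
def maskedTriState {d s dA dB k : ℕ}
    (M : Matrix (Fin dA × Fin dB) (Fin d × Fin s) ℂ)
    (Ω : Fin s × Fin k → ℂ) (ρ : Matrix (Fin d) (Fin d) ℂ) :
    Matrix ((Fin dA × Fin dB) × Fin k) ((Fin dA × Fin dB) × Fin k) ℂ :=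
  (M ⊗ₖ (1 : Matrix (Fin k) (Fin k) ℂ)) *
    (Matrix.reindex (Equiv.prodAssoc (Fin d) (Fin s) (Fin k)).symm
      (Equiv.prodAssoc (Fin d) (Fin s) (Fin k)).symm (ρ ⊗ₖ outer Ω)) *
    (M ⊗ₖ (1 : Matrix (Fin k) (Fin k) ℂ))ᴴ

/-- A Kraus representation over an arbitrary finite index type gives a quantum channel. -/
theorem exists_isCPTP_of_kraus {m n κ : Type*} [Fintype m] [Fintype n] [DecidableEq m]
    [Fintype κ] (K : κ → Matrix n m ℂ) (hK : ∑ k, (K k)ᴴ * K k = 1) :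
    ∃ E : Matrix m m ℂ →ₗ[ℂ] Matrix n n ℂ, IsCPTP E ∧ ∀ A, E A = ∑ k, K k * A * (K k)ᴴ := by
  let e := (Fintype.equivFin κ).symm
  refine ⟨{ toFun := fun A => ∑ k, K k * A * (K k)ᴴ
            map_add' := fun A B => by
              simp [Matrix.mul_add, Matrix.add_mul, Finset.sum_add_distrib]
            map_smul' := fun c A => by simp [Finset.smul_sum] },
    ⟨Fintype.card κ, fun i => K (e i), fun A => ?_, ?_⟩, fun A => rfl⟩
  · exact (e.sum_comp fun k => K k * A * (K k)ᴴ).symm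
  · exact (e.sum_comp fun k => (K k)ᴴ * K k).trans hK

/-- Recovery channel for Kraus operators with mutually orthogonal ranges, each proportional to
an isometry. -/
theorem exists_recovery_of_orthogonal {m n ι : Type*} [Fintype m] [Fintype n] [Fintype ι]
    [DecidableEq m] [DecidableEq n] [DecidableEq ι] [Nonempty n]
    (W : ι → Matrix m n ℂ) (p : ι → ℝ) (hp : ∀ i, 0 ≤ p i) (hsum : ∑ i, p i = 1)
    (hW : ∀ i j, (W i)ᴴ * W j = if i = j then (p i : ℂ) • 1 else 0) :
    ∃ R : Matrix m m ℂ →ₗ[ℂ] Matrix n n ℂ, IsCPTP R ∧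
      ∀ ρ : Matrix n n ℂ, R (∑ i, W i * ρ * (W i)ᴴ) = ρ := by
  let n₀ : n := Classical.arbitrary n
  let P : Matrix m m ℂ := ∑ i, ((p i : ℂ)⁻¹) • (W i * (W i)ᴴ)
  have hPW : ∀ j, P * W j = W j := by
    intro j
    by_cases hj : p j = 0
    · have h0 : W j = 0 := by
        have := hW j j
        simpa [hj] using this
      simp [h0]
    · have hj' : (p j : ℂ) ≠ 0 := by exact_mod_cast hj
      simp only [P, Matrix.sum_mul, Matrix.smul_mul, Matrix.mul_assoc, hW]
      rw [Finset.sum_eq_single j (fun i _ hi => by simp [hi]) (by simp)]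
      simp only [if_true, Matrix.mul_smul, Matrix.mul_one, smul_smul, inv_mul_cancel₀ hj',
        one_smul]
  have hPP : P * P = P := by
    conv_lhs => rw [show P * P = P * ∑ i, ((p i : ℂ)⁻¹) • (W i * (W i)ᴴ) from rfl]
    simp only [Matrix.mul_sum, Matrix.mul_smul, ← Matrix.mul_assoc, hPW]
    rfl
  have hPH : Pᴴ = P := by
    simp [P, Matrix.conjTranspose_sum, Matrix.conjTranspose_smul]
  let c : ι → ℂ := fun i => ((Real.sqrt (p i))⁻¹ : ℝ)
  have hc : ∀ i, star (c i) = c i := fun i => Complex.conj_ofReal _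
  have hcc : ∀ i, c i * c i = (p i : ℂ)⁻¹ := by
    intro i
    simp only [c, ← Complex.ofReal_mul, ← mul_inv, Real.mul_self_sqrt (hp i),
      Complex.ofReal_inv]
  let S : m → Matrix n m ℂ := fun x => Matrix.single n₀ x 1
  have hS : ∑ x, (S x)ᴴ * S x = 1 := by
    simp only [S, Matrix.conjTranspose_single, star_one, Matrix.single_mul_single_same, mul_one]
    exact Matrix.sum_single_one
  let K : ι ⊕ m → Matrix n m ℂ := Sum.elim (fun i => c i • (W i)ᴴ) (fun x => S x * (1 - P))
  have hK : ∑ k, (K k)ᴴ * K k = 1 := by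
    have h1 : ∑ i, (c i • (W i)ᴴ)ᴴ * (c i • (W i)ᴴ) = P := by
      simp [P, Matrix.conjTranspose_smul, smul_smul, hc, hcc]
    have h2 : ∑ x, (S x * (1 - P))ᴴ * (S x * (1 - P)) = 1 - P := by
      have h3 : ∀ x, (S x * (1 - P))ᴴ * (S x * (1 - P)) = (1 - P) * ((S x)ᴴ * S x) * (1 - P) := by
        intro x
        simp only [Matrix.conjTranspose_mul, Matrix.conjTranspose_sub, hPH,
          Matrix.conjTranspose_one, Matrix.mul_assoc]
      simp only [h3, ← Matrix.sum_mul, ← Matrix.mul_sum]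
      rw [hS, Matrix.mul_one, Matrix.mul_sub, Matrix.sub_mul, Matrix.sub_mul, hPP]
      simp
    simp only [Fintype.sum_sum_type, K, Sum.elim_inl, Sum.elim_inr]
    rw [h1, h2, add_sub_cancel]
  obtain ⟨R, hR, hRK⟩ := exists_isCPTP_of_kraus K hK
  refine ⟨R, hR, fun ρ => ?_⟩
  have hinl : ∀ i j, K (Sum.inl i) * (W j * ρ * (W j)ᴴ) * (K (Sum.inl i))ᴴ =
      if i = j then (p i : ℂ) • ρ else 0 := by
    intro i j
    have h1 : K (Sum.inl i) * W j = c i • if i = j then (p i : ℂ) • 1 else 0 := by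
      simp [K, hW]
    have h2 : K (Sum.inl i) * (W j * ρ * (W j)ᴴ) * (K (Sum.inl i))ᴴ =
        (K (Sum.inl i) * W j) * ρ * (K (Sum.inl i) * W j)ᴴ := by
      simp only [Matrix.conjTranspose_mul, Matrix.mul_assoc]
    rw [h2, h1]
    split_ifs with hij
    · by_cases hi : p i = 0
      · simp [hi]
      · have hi' : (p i : ℂ) ≠ 0 := by exact_mod_cast hi
        have h3 : star (c i) = c i := hc i
        simp only [Matrix.conjTranspose_smul, Matrix.conjTranspose_one, Matrix.smul_mul,
          Matrix.mul_smul, Matrix.one_mul, Matrix.mul_one, smul_smul]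
        congr 1
        rw [star_mul', h3, Complex.star_def, Complex.conj_ofReal]
        calc _ = (c i * c i) * p i * p i := by ring
          _ = _ := by rw [hcc]; field_simp
    · simp
  have hinr : ∀ x j, K (Sum.inr x) * (W j * ρ * (W j)ᴴ) * (K (Sum.inr x))ᴴ = 0 := by
    intro x j
    have h1 : K (Sum.inr x) * W j = 0 := by
      change S x * (1 - P) * W j = 0
      rw [Matrix.mul_assoc, Matrix.sub_mul, hPW, Matrix.one_mul, sub_self, Matrix.mul_zero]
    rw [← Matrix.mul_assoc, ← Matrix.mul_assoc, h1]
    simp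
  rw [hRK]
  simp only [Fintype.sum_sum_type, Matrix.mul_sum, Matrix.sum_mul, hinl, hinr]
  simp only [Finset.sum_ite_eq, Finset.mem_univ, if_true, Finset.sum_const_zero, add_zero]
  rw [← Finset.sum_smul, ← Complex.ofReal_sum, hsum, Complex.ofReal_one, one_smul]

/-- **Knill–Laflamme**: if the Kraus operators `V` satisfy `V b† V a = σ a b • 1` for a density
matrix `σ`, then the channel they define can be inverted by a quantum channel. -/
theorem exists_recovery_of_knillLaflamme {m n ι : Type*} [Fintype m] [Fintype n] [Fintype ι]
    [DecidableEq m] [DecidableEq n] [DecidableEq ι] [Nonempty n]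
    (V : ι → Matrix m n ℂ) {σ : Matrix ι ι ℂ} (hσ : IsDensity σ)
    (hV : ∀ a b, (V b)ᴴ * V a = σ a b • 1) :
    ∃ R : Matrix m m ℂ →ₗ[ℂ] Matrix n n ℂ, IsCPTP R ∧
      ∀ ρ : Matrix n n ℂ, R (∑ a, V a * ρ * (V a)ᴴ) = ρ := by
  have hH := hσ.1.isHermitian
  let U : Matrix ι ι ℂ := hH.eigenvectorUnitary
  have hUU : U * Uᴴ = 1 := Unitary.coe_mul_star_self hH.eigenvectorUnitary
  have hdiag : Uᴴ * σ * U = diagonal (fun i => (hH.eigenvalues i : ℂ)) := by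
    have h1 : Uᴴ * U = 1 := Unitary.coe_star_mul_self hH.eigenvectorUnitary
    have h2 : σ = U * diagonal (fun i => (hH.eigenvalues i : ℂ)) * Uᴴ := hH.spectral_theorem
    calc Uᴴ * σ * U = Uᴴ * (U * diagonal (fun i => (hH.eigenvalues i : ℂ)) * Uᴴ) * U :=
          congrArg (fun A => Uᴴ * A * U) h2
      _ = (Uᴴ * U) * diagonal (fun i => (hH.eigenvalues i : ℂ)) * (Uᴴ * U) := by
          simp only [Matrix.mul_assoc]
      _ = _ := by rw [h1, Matrix.one_mul, Matrix.mul_one]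
  let W : ι → Matrix m n ℂ := fun j => ∑ a, star (U a j) • V a
  have hW : ∀ i j, (W i)ᴴ * W j = if i = j then (hH.eigenvalues i : ℂ) • 1 else 0 := by
    intro i j
    have h1 : (W i)ᴴ * W j = (Uᴴ * σ * U) j i • 1 := by
      simp only [W, Matrix.conjTranspose_sum, Matrix.conjTranspose_smul, star_star,
        Matrix.sum_mul, Matrix.mul_sum, Matrix.smul_mul, Matrix.mul_smul, hV, smul_smul,
        ← Finset.sum_smul, Matrix.mul_apply, Matrix.conjTranspose_apply, Finset.sum_mul,
        Finset.mul_sum]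
      congr 1
      rw [Finset.sum_comm]
      refine Finset.sum_congr rfl fun a _ => Finset.sum_congr rfl fun b _ => ?_
      ring
    rw [h1, hdiag, Matrix.diagonal_apply]
    by_cases h : i = j
    · subst h; simp
    · simp [h, Ne.symm h]
  have hsum : ∑ i, hH.eigenvalues i = 1 := by
    have := hH.trace_eq_sum_eigenvalues
    rw [hσ.2] at this
    exact Complex.ofReal_injective (by simpa using this.symm)
  obtain ⟨R, hR, h⟩ := exists_recovery_of_orthogonal W hH.eigenvalues
    hσ.1.eigenvalues_nonneg hsum hW
  refine ⟨R, hR, fun ρ => ?_⟩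
  convert h ρ using 2
  have hU : ∀ a b, ∑ j, star (U a j) * U b j = if a = b then 1 else 0 := by
    intro a b
    have := congrFun (congrFun hUU b) a
    simp only [Matrix.mul_apply, Matrix.conjTranspose_apply, Matrix.one_apply] at this
    simp only [mul_comm (star _), this, eq_comm]
  have h1 : ∀ j, W j * ρ * (W j)ᴴ =
      ∑ a, ∑ b, (star (U a j) * U b j) • (V a * ρ * (V b)ᴴ) := by
    intro j
    simp only [W, Matrix.conjTranspose_sum, Matrix.conjTranspose_smul, star_star,
        Matrix.sum_mul, Matrix.mul_sum, Matrix.smul_mul, Matrix.mul_smul]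
    rw [Finset.sum_comm]
    simp only [Finset.smul_sum, smul_smul, mul_comm]
  simp only [h1]
  rw [Finset.sum_comm]
  refine Finset.sum_congr rfl fun a _ => ?_
  rw [Finset.sum_comm]
  simp only [← Finset.sum_smul, hU]
  simp

/-- A matrix whose expectation value is the same in all states is scalar. -/
theorem eq_smul_one_of_trace_mul_density {n : Type*} [Fintype n] [DecidableEq n]
    {X : Matrix n n ℂ} {c : ℂ} (h : ∀ ρ : Matrix n n ℂ, IsDensity ρ → (X * ρ).trace = c) :
    X = c • 1 := by
  have hv : ∀ v : n → ℂ, star v ⬝ᵥ ((X - c • 1) *ᵥ v) = 0 := by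
    intro v
    by_cases hv : v = 0
    · simp [hv]
    have htr : (vecMulVec v (star v)).trace ≠ 0 := by
      rwa [Matrix.trace_vecMulVec, Ne, dotProduct_comm, dotProduct_star_self_eq_zero]
    have hpos : 0 ≤ (vecMulVec v (star v)).trace := (posSemidef_vecMulVec_self_star v).trace_nonneg
    set t := (vecMulVec v (star v)).trace with ht
    have hd : IsDensity (t⁻¹ • vecMulVec v (star v)) := by
      refine ⟨(posSemidef_vecMulVec_self_star v).smul (inv_nonneg.2 hpos), ?_⟩
      rw [Matrix.trace_smul, ← ht, smul_eq_mul, inv_mul_cancel₀ htr]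
    have h1 := h _ hd
    rw [Matrix.mul_smul, Matrix.trace_smul, smul_eq_mul, inv_mul_eq_iff_eq_mul₀ htr,
      Matrix.mul_vecMulVec, Matrix.trace_vecMulVec] at h1
    rw [Matrix.sub_mulVec, dotProduct_sub, dotProduct_comm, h1, ht, Matrix.trace_vecMulVec,
      Matrix.smul_mulVec, Matrix.one_mulVec, dotProduct_smul, smul_eq_mul,
      dotProduct_comm v, mul_comm, sub_self]
  rw [← sub_eq_zero]
  have h0 : (X - c • 1).toEuclideanLin = 0 := by
    rw [← inner_map_self_eq_zero]
    intro x
    rw [EuclideanSpace.inner_eq_star_dotProduct, Matrix.ofLp_toLpLin,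
      Matrix.toLin'_apply, dotProduct_comm]
    have := congrArg star (hv x.ofLp)
    rwa [star_zero, Matrix.star_dotProduct, star_star] at this
  exact (LinearEquiv.map_eq_zero_iff _).1 h0

/-- The isometry `|i⟩ ↦ |i⟩ ⊗ |Ω⟩`. -/
def attachState {n a b : Type*} [DecidableEq n] (Ω : a × b → ℂ) : Matrix ((n × a) × b) n ℂ :=
  Matrix.of fun q i => if q.1.1 = i then Ω (q.1.2, q.2) else 0

/-- The isometry `|i⟩ ↦ (M ⊗ I)(|i⟩ ⊗ |Ω⟩)`. -/
def maskingIsometry {d s dA dB k : ℕ} (M : Matrix (Fin dA × Fin dB) (Fin d × Fin s) ℂ)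
    (Ω : Fin s × Fin k → ℂ) : Matrix ((Fin dA × Fin dB) × Fin k) (Fin d) ℂ :=
  (M ⊗ₖ (1 : Matrix (Fin k) (Fin k) ℂ)) *
    (attachState Ω : Matrix ((Fin d × Fin s) × Fin k) (Fin d) ℂ)

theorem reindex_kronecker_outer {n a b : Type*} [Fintype n] [DecidableEq n] (Ω : a × b → ℂ)
    (ρ : Matrix n n ℂ) :
    Matrix.reindex (Equiv.prodAssoc n a b).symm (Equiv.prodAssoc n a b).symm (ρ ⊗ₖ outer Ω) =
      (attachState Ω : Matrix ((n × a) × b) n ℂ) * ρ *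
        (attachState Ω : Matrix ((n × a) × b) n ℂ)ᴴ := by
  ext ⟨⟨i, u⟩, x⟩ ⟨⟨i', u'⟩, x'⟩
  simp [Matrix.mul_apply, outer, attachState, kroneckerMap_apply, apply_ite]
  ring

theorem maskedTriState_eq {d s dA dB k : ℕ} (M : Matrix (Fin dA × Fin dB) (Fin d × Fin s) ℂ)
    (Ω : Fin s × Fin k → ℂ) (ρ : Matrix (Fin d) (Fin d) ℂ) :
    maskedTriState M Ω ρ = maskingIsometry M Ω * ρ * (maskingIsometry M Ω)ᴴ := by
  rw [maskedTriState, reindex_kronecker_outer, maskingIsometry, Matrix.conjTranspose_mul]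
  simp only [Matrix.mul_assoc]

/-- if the marginal of `Ψ(ρ)` on the first factor is constant, then `ρ` can be
recovered from the remaining two factors by a quantum channel. -/
theorem recoverability_from_complement
    (d s dA dB k : ℕ)
    (M : Matrix (Fin dA × Fin dB) (Fin d × Fin s) ℂ)
    (hM : Mᴴ * M = 1 ∧ M * Mᴴ = 1)
    (Ω : Fin s × Fin k → ℂ) (hΩ : ∑ x, ‖Ω x‖ ^ 2 = 1)
    (σA : Matrix (Fin dA) (Fin dA) ℂ) (hσA : IsDensity σA)
    (hconst : ∀ ρ : Matrix (Fin d) (Fin d) ℂ, IsDensity ρ →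
      ptraceBK (maskedTriState M Ω ρ) = σA) :
    ∃ R : Matrix (Fin dB × Fin k) (Fin dB × Fin k) ℂ →ₗ[ℂ] Matrix (Fin d) (Fin d) ℂ,
      IsCPTP R ∧
      ∀ ρ : Matrix (Fin d) (Fin d) ℂ, IsDensity ρ →
        R (ptraceA3 (maskedTriState M Ω ρ)) = ρ := by
  let V : Fin dA → Matrix (Fin dB × Fin k) (Fin d) ℂ := fun a =>
    Matrix.of fun q i => maskingIsometry M Ω ((a, q.1), q.2) i
  have hΨ : ∀ (ρ : Matrix (Fin d) (Fin d) ℂ) a a' (q q' : Fin dB × Fin k),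
      maskedTriState M Ω ρ ((a, q.1), q.2) ((a', q'.1), q'.2) = (V a * ρ * (V a')ᴴ) q q' := by
    intro ρ a a' q q'
    rw [maskedTriState_eq]
    rfl
  have hA : ∀ ρ, ptraceA3 (maskedTriState M Ω ρ) = ∑ a, V a * ρ * (V a)ᴴ := by
    intro ρ
    ext q q'
    simp only [ptraceA3, Matrix.of_apply, hΨ, Matrix.sum_apply]
  have hKL : ∀ a b, (V b)ᴴ * V a = σA a b • 1 := by
    intro a b
    refine eq_smul_one_of_trace_mul_density fun ρ hρ => ?_
    rw [Matrix.mul_assoc, Matrix.trace_mul_comm, ← hconst ρ hρ, Matrix.trace,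
      Fintype.sum_prod_type]
    simp only [ptraceBK, Matrix.of_apply, Matrix.diag_apply, ← hΨ]
  rcases Nat.eq_zero_or_pos d with rfl | hd
  · have hdA : Nonempty (Fin dA) := by
      by_contra hne
      rw [not_nonempty_iff] at hne
      simpa [Matrix.trace] using hσA.2
    have hdB : IsEmpty (Fin dB) := by
      refine ⟨fun b => ?_⟩
      have a : Fin dA := hdA.some
      have := congrFun (congrFun hM.2 (a, b)) (a, b)
      simp [Matrix.mul_apply] at this
    exact ⟨0, ⟨0, Fin.elim0, fun A => Subsingleton.elim _ _, Subsingleton.elim _ _⟩,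
      fun ρ _ => Subsingleton.elim _ _⟩
  · have : Nonempty (Fin d) := ⟨⟨0, hd⟩⟩
    obtain ⟨R, hR, h⟩ := exists_recovery_of_knillLaflamme V hσA hKL
    exact ⟨R, hR, fun ρ _ => by rw [hA, h]⟩

end
end

section
/- The minimal two-qudit masker works in odd dimension: let d ≥ 3 be odd, and on ℂ^d⊗ℂ^d define the unitaries U|x⟩⊗|y⟩ = |x+y mod d⟩⊗|y⟩ (addition controlled by the second system) and W|x⟩⊗|y⟩ = |x⟩⊗|y+x mod d⟩ (addition controlled by the first system), and set V = W·U. Then for every density matrix ρ on ℂ^d, the output state V(ρ ⊗ (1/d)I_d)V† has both marginals maximally mixed: its partial trace over the second factor equals (1/d)I_d and its partial trace over the first factor equals (1/d)I_d. In particular (V, (1/d)I_d) is a universal quantum masker for d-dimensional states. -/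
open Matrix Kronecker
open scoped ComplexOrder

noncomputable section

section AddCommGroup

variable {G : Type*} [AddCommGroup G]

/-- The shear `(x, y) ↦ (x + y, x + 2 y)` implemented by the two controlled additions. -/
def maskerEquiv (G : Type*) [AddCommGroup G] : G × G ≃ G × G where
  toFun p := (p.1 + p.2, p.2 + (p.1 + p.2))
  invFun p := (p.1 + p.1 - p.2, p.2 - p.1)
  left_inv p := by ext <;> simp only <;> abel
  right_inv p := by ext <;> simp only <;> abel

theorem maskerEquiv_symm_apply (a b : G) :
    (maskerEquiv G).symm (a, b) = (a + a - b, b - a) := rfl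

theorem bijective_add_self_of_odd_card [Fintype G] (hG : Odd (Fintype.card G)) :
    Function.Bijective fun x : G => x + x := by
  have hcop : (Nat.card G).Coprime 2 := by
    rw [Nat.card_eq_fintype_card]
    exact Nat.coprime_two_right.mpr hG
  simpa [two_nsmul] using (nsmulCoprime hcop).bijective

variable [Fintype G] [DecidableEq G]

theorem controlledAdd_mul_eq_submatrix (U W : Matrix (G × G) (G × G) ℂ)
    (hU : ∀ a b x y : G, U (a, b) (x, y) = if a = x + y ∧ b = y then 1 else 0)
    (hW : ∀ a b x y : G, W (a, b) (x, y) = if a = x ∧ b = y + x then 1 else 0) :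
    W * U = (1 : Matrix (G × G) (G × G) ℂ).submatrix (maskerEquiv G).symm id := by
  ext ⟨a, b⟩ ⟨x, y⟩
  have hU' : ∀ p : G × G, U p (x, y) = if p = (x + y, y) then 1 else 0 := by
    rintro ⟨p, q⟩
    simp [hU]
  have hiff : (a = x + y ∧ b = y + (x + y)) ↔ (maskerEquiv G).symm (a, b) = (x, y) := by
    rw [Equiv.symm_apply_eq]
    simp [maskerEquiv]
  simp [Matrix.mul_apply, hU', hW, Matrix.one_apply, hiff]

theorem one_submatrix_mul_conjTranspose {n : Type*} [Fintype n] [DecidableEq n]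
    (e : n ≃ n) (M : Matrix n n ℂ) :
    (1 : Matrix n n ℂ).submatrix e id * M * ((1 : Matrix n n ℂ).submatrix e id)ᴴ =
      M.submatrix e e := by
  rw [Matrix.conjTranspose_submatrix, Matrix.conjTranspose_one]
  ext i j
  simp [Matrix.mul_apply, Matrix.one_apply]

theorem ptrace2_maskerEquiv (ρ : Matrix G G ℂ) (c : ℂ) :
    ptrace2 ((ρ ⊗ₖ (c • (1 : Matrix G G ℂ))).submatrix
      (maskerEquiv G).symm (maskerEquiv G).symm) = (c * ρ.trace) • (1 : Matrix G G ℂ) := by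
  ext a a'
  rcases eq_or_ne a a' with rfl | h
  · have hsum : ∑ b, ρ (a + a - b) (a + a - b) = ρ.trace :=
      (Equiv.subLeft (a + a)).sum_comp fun x => ρ x x
    simp [ptrace2, maskerEquiv_symm_apply, mul_comm _ c, ← Finset.mul_sum, hsum]
  · simp [ptrace2, maskerEquiv_symm_apply, Matrix.one_apply, h]

theorem ptrace1_maskerEquiv (hG : Function.Bijective fun x : G => x + x)
    (ρ : Matrix G G ℂ) (c : ℂ) :
    ptrace1 ((ρ ⊗ₖ (c • (1 : Matrix G G ℂ))).submatrix
      (maskerEquiv G).symm (maskerEquiv G).symm) = (c * ρ.trace) • (1 : Matrix G G ℂ) := by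
  ext b b'
  rcases eq_or_ne b b' with rfl | h
  · have hsum : ∑ a, ρ (a + a - b) (a + a - b) = ρ.trace :=
      ((Equiv.ofBijective _ hG).trans (Equiv.subRight b)).sum_comp fun x => ρ x x
    simp [ptrace1, maskerEquiv_symm_apply, mul_comm _ c, ← Finset.mul_sum, hsum]
  · simp [ptrace1, maskerEquiv_symm_apply, Matrix.one_apply, h]

end AddCommGroup

theorem isDensity_maximallyMixed {n : Type*} [Fintype n] [DecidableEq n] [Nonempty n] :
    IsDensity ((Fintype.card n : ℂ)⁻¹ • (1 : Matrix n n ℂ)) := by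
  refine ⟨Matrix.PosSemidef.one.smul (by positivity), ?_⟩
  simp [Matrix.trace_smul]

/-- the minimal two-qudit masker `V = W·U` with maximally mixed safe state
works in every odd dimension `d ≥ 3`: both marginals of the output are maximally mixed, and
`(V, (1/d)I)` is a universal quantum masker for `d`-dimensional states. -/
theorem minimal_masker_odd_dimension
    (d : ℕ) (hd : 3 ≤ d) (hodd : Odd d)
    (U W V : Matrix (Fin d × Fin d) (Fin d × Fin d) ℂ)
    (hU : ∀ a b x y : Fin d, U (a, b) (x, y) = if a = x + y ∧ b = y then 1 else 0)
    (hW : ∀ a b x y : Fin d, W (a, b) (x, y) = if a = x ∧ b = y + x then 1 else 0)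
    (hV : V = W * U) :
    (∀ ρ : Matrix (Fin d) (Fin d) ℂ, IsDensity ρ →
      ptrace2 (V * (ρ ⊗ₖ ((d : ℂ)⁻¹ • (1 : Matrix (Fin d) (Fin d) ℂ))) * Vᴴ) =
        (d : ℂ)⁻¹ • (1 : Matrix (Fin d) (Fin d) ℂ) ∧
      ptrace1 (V * (ρ ⊗ₖ ((d : ℂ)⁻¹ • (1 : Matrix (Fin d) (Fin d) ℂ))) * Vᴴ) =
        (d : ℂ)⁻¹ • (1 : Matrix (Fin d) (Fin d) ℂ)) ∧
    IsMasker d d d d V ((d : ℂ)⁻¹ • (1 : Matrix (Fin d) (Fin d) ℂ)) := by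
  have : NeZero d := ⟨by omega⟩
  have hV' : V = (1 : Matrix (Fin d × Fin d) (Fin d × Fin d) ℂ).submatrix
      (maskerEquiv (Fin d)).symm id := hV.trans (controlledAdd_mul_eq_submatrix U W hU hW)
  have hbij : Function.Bijective fun x : Fin d => x + x :=
    bijective_add_self_of_odd_card (by simpa using hodd)
  have hVV : V * Vᴴ = 1 := by
    simpa [hV'] using one_submatrix_mul_conjTranspose (maskerEquiv (Fin d)).symm 1
  have hω : IsDensity ((d : ℂ)⁻¹ • (1 : Matrix (Fin d) (Fin d) ℂ)) := by
    simpa using isDensity_maximallyMixed (n := Fin d)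
  have hmarginals : ∀ ρ : Matrix (Fin d) (Fin d) ℂ, IsDensity ρ →
      ptrace2 (V * (ρ ⊗ₖ ((d : ℂ)⁻¹ • (1 : Matrix (Fin d) (Fin d) ℂ))) * Vᴴ) =
        (d : ℂ)⁻¹ • (1 : Matrix (Fin d) (Fin d) ℂ) ∧
      ptrace1 (V * (ρ ⊗ₖ ((d : ℂ)⁻¹ • (1 : Matrix (Fin d) (Fin d) ℂ))) * Vᴴ) =
        (d : ℂ)⁻¹ • (1 : Matrix (Fin d) (Fin d) ℂ) := by
    intro ρ hρ
    rw [hV', one_submatrix_mul_conjTranspose, ptrace2_maskerEquiv, ptrace1_maskerEquiv hbij,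
      hρ.2, mul_one]
    exact ⟨rfl, rfl⟩
  exact ⟨hmarginals, mul_eq_one_comm.mp hVV, hVV, hω, _, _, hω, hω, hmarginals⟩

end
end
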